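/- arXiv:2311.00080 — 2 statements merged into one kernel-verified Lean document; each statement's English description precedes it below -/
import Mathlib

section
/- Let G be a group admitting a central extension 1 → A → K → G → 1 with K circularly orderable, and suppose H₂(G) is torsion-free. Then the exterior square G ∧ G is circularly orderable. If moreover K is left-orderable, then G ∧ G is left-orderable. -/
universe u v

/-- A group is left-orderable if it admits a left-invariant strict total order. -/
def IsLeftOrderable (G : Type u) [Group G] : Prop :=
  ∃ r : G → G → Prop, IsStrictTotalOrder G r ∧ ∀ h a b : G, r a b → r (h * a) (h * b)

/-- A group is circularly orderable if it admits a left-invariant circular order cocycle. -/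
def IsCircularlyOrderable (G : Type u) [Group G] : Prop :=
  ∃ c : G → G → G → ℤ,
    (∀ g₁ g₂ g₃ : G, c g₁ g₂ g₃ = -1 ∨ c g₁ g₂ g₃ = 0 ∨ c g₁ g₂ g₃ = 1) ∧
    (∀ g₁ g₂ g₃ : G, c g₁ g₂ g₃ = 0 ↔ g₁ = g₂ ∨ g₁ = g₃ ∨ g₂ = g₃) ∧
    (∀ g₁ g₂ g₃ g₄ : G, c g₂ g₃ g₄ - c g₁ g₃ g₄ + c g₁ g₂ g₄ - c g₁ g₂ g₃ = 0) ∧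
    (∀ h g₁ g₂ g₃ : G, c g₁ g₂ g₃ = c (h * g₁) (h * g₂) (h * g₃))

/-- The kernel of the canonical presentation `FreeGroup G → G`. -/
def presKernel (G : Type u) [Group G] : Subgroup (FreeGroup G) :=
  (FreeGroup.lift (id : G → G)).ker

instance (G : Type u) [Group G] : (presKernel G).Normal :=
  MonoidHom.normal_ker _

/-- The second homology group `H₂(G; ℤ)` computed via Hopf's formula:
`H₂(G) = (R ⊓ [F, F]) / [F, R]` for the canonical free presentation `G = F/R`,
`F = FreeGroup G`. -/
def H2 (G : Type u) [Group G] : Type u :=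
  ↥(presKernel G ⊓ commutator (FreeGroup G)) ⧸
    ((⁅(⊤ : Subgroup (FreeGroup G)), presKernel G⁆).subgroupOf
      (presKernel G ⊓ commutator (FreeGroup G)))

noncomputable instance (G : Type u) [Group G] : Group (H2 G) := by
  unfold H2; infer_instance

/-- The defining relators of the nonabelian tensor square `G ⊗ G`. -/
def tensorSquareRels (G : Type u) [Group G] : Set (FreeGroup (G × G)) :=
  {r | ∃ g h k : G,
    r = FreeGroup.of (g * h, k) *
        (FreeGroup.of (g * h * g⁻¹, g * k * g⁻¹) * FreeGroup.of (g, k))⁻¹ ∨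
    r = FreeGroup.of (g, h * k) *
        (FreeGroup.of (g, h) * FreeGroup.of (h * g * h⁻¹, h * k * h⁻¹))⁻¹}

/-- The nonabelian tensor square `G ⊗ G`. -/
def TensorSquare (G : Type u) [Group G] : Type u :=
  PresentedGroup (tensorSquareRels G)

instance (G : Type u) [Group G] : Group (TensorSquare G) := by
  unfold TensorSquare; infer_instance

/-- The generator `g ⊗ h` of the nonabelian tensor square. -/
def tmul {G : Type u} [Group G] (g h : G) : TensorSquare G :=
  PresentedGroup.of (g, h)

/-- The exterior square `G ∧ G`: the quotient of `G ⊗ G` by the normal closure of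
the elements `g ⊗ g`. -/
def ExteriorSquare (G : Type u) [Group G] : Type u :=
  TensorSquare G ⧸ Subgroup.normalClosure {t : TensorSquare G | ∃ g : G, t = tmul g g}

noncomputable instance (G : Type u) [Group G] : Group (ExteriorSquare G) := by
  unfold ExteriorSquare; infer_instance

/-! ### Orderings on group extensions -/

/-- A strict positive cone on the subgroup `N`: a left-invariant order on `N`, recorded by its
set of positive elements. -/
structure IsPositiveCone {E : Type*} [Group E] (N : Subgroup E) (P : Set E) : Prop where
  one_notMem : (1 : E) ∉ P
  mul_mem : ∀ {x y : E}, x ∈ P → y ∈ P → x * y ∈ P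
  mem_or_inv_mem : ∀ {x : E}, x ∈ N → x ≠ 1 → x ∈ P ∨ x⁻¹ ∈ P
  subset : ∀ {x : E}, x ∈ P → x ∈ N

open scoped TensorProduct in
theorem exists_isPositiveCone_of_torsionFree {E : Type*} [Group E] (N : Subgroup E)
    (hcomm : ∀ x ∈ N, ∀ y ∈ N, x * y = y * x) (htf : ∀ x ∈ N, IsOfFinOrder x → x = 1) :
    ∃ P : Set E, IsPositiveCone N P := by
  let _ : CommGroup N := { (inferInstance : Group N) with
    mul_comm := fun x y => Subtype.ext (hcomm x x.2 y y.2) }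
  have : IsMulTorsionFree N := by
    rw [isMulTorsionFree_iff_not_isOfFinOrder]
    intro a ha hfin
    exact ha (Subtype.ext (htf a a.2 (Submonoid.isOfFinOrder_coe.mpr hfin)))
  let f : Additive N →ₗ[ℤ] TensorProduct ℤ ℚ (Additive N) :=
    TensorProduct.mk ℤ ℚ (Additive N) 1
  have hf : Function.Injective f := by
    have hinj : Function.Injective (Algebra.linearMap ℤ ℚ) := by
      intro a b h
      simpa using h
    have h := Module.Flat.rTensor_preserves_injective_linearMap (M := Additive N) _ hinj
    have hcomp := h.comp (TensorProduct.lid ℤ (Additive N)).symm.injective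
    intro a b hab
    apply hcomp
    have hab' : (1 : ℚ) ⊗ₜ[ℤ] a = (1 : ℚ) ⊗ₜ[ℤ] b := hab
    simpa using hab'
  let b := Module.Basis.ofVectorSpace ℚ (TensorProduct ℤ ℚ (Additive N))
  classical
  let _ : LinearOrder (Module.Basis.ofVectorSpaceIndex ℚ (TensorProduct ℤ ℚ (Additive N))) :=
    linearOrderOfSTO WellOrderingRel
  let g : N → Lex (Module.Basis.ofVectorSpaceIndex ℚ (TensorProduct ℤ ℚ (Additive N)) →₀ ℚ) :=
    fun x => toLex (b.repr (f (Additive.ofMul x)))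
  have hg1 : g 1 = 0 := by simp [g]
  have hgmul : ∀ x y, g (x * y) = g x + g y := by intro x y; simp [g]
  have hginj : Function.Injective g := fun x y h =>
    Additive.ofMul.injective (hf (b.repr.injective (toLex.injective h)))
  refine ⟨{x | ∃ h : x ∈ N, 0 < g ⟨x, h⟩}, ?_, ?_, ?_, ?_⟩
  · rintro ⟨h, h0⟩
    have : (⟨1, h⟩ : N) = 1 := rfl
    rw [this, hg1] at h0
    exact lt_irrefl _ h0
  · rintro x y ⟨hx, hx0⟩ ⟨hy, hy0⟩
    refine ⟨N.mul_mem hx hy, ?_⟩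
    have : (⟨x * y, N.mul_mem hx hy⟩ : N) = ⟨x, hx⟩ * ⟨y, hy⟩ := rfl
    rw [this, hgmul]
    exact add_pos hx0 hy0
  · intro x hx hx1
    have hne : g ⟨x, hx⟩ ≠ 0 := by
      rw [← hg1]
      exact fun h => hx1 (congrArg Subtype.val (hginj h))
    have hinv : g ⟨x⁻¹, N.inv_mem hx⟩ = - g ⟨x, hx⟩ := by
      rw [eq_neg_iff_add_eq_zero, ← hgmul, ← hg1]
      congr 1
      exact Subtype.ext (inv_mul_cancel x)
    rcases lt_or_gt_of_ne hne with h | h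
    · exact Or.inr ⟨N.inv_mem hx, by rw [hinv]; exact neg_pos.mpr h⟩
    · exact Or.inl ⟨hx, h⟩
  · rintro x ⟨hx, -⟩
    exact hx

theorem IsPositiveCone.inv_notMem {E : Type*} [Group E] {N : Subgroup E} {P : Set E}
    (hP : IsPositiveCone N P) {x : E} (hx : x ∈ P) : x⁻¹ ∉ P := fun h =>
  hP.one_notMem (by simpa using hP.mul_mem hx h)

theorem IsPositiveCone.isLeftOrderable {E K : Type*} [Group E] [Group K] (f : E →* K)
    {P : Set E} (hP : IsPositiveCone f.ker P) (hK : IsLeftOrderable K) : IsLeftOrderable E := by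
  obtain ⟨r, hr, hinv⟩ := hK
  have hfP : ∀ {a b : E}, a⁻¹ * b ∈ P → f a = f b := fun h => by
    have := hP.subset h
    rwa [MonoidHom.mem_ker, map_mul, map_inv, inv_mul_eq_one] at this
  refine ⟨fun a b => r (f a) (f b) ∨ a⁻¹ * b ∈ P, ?_, ?_⟩
  · refine { trichotomous := ?_, irrefl := ?_, trans := ?_ }
    · intro a b hab hba
      rw [not_or] at hab hba
      have hf : f a = f b := hr.trichotomous _ _ hab.1 hba.1
      by_contra hne
      have hmem : a⁻¹ * b ∈ f.ker := by rw [MonoidHom.mem_ker, map_mul, map_inv, hf, inv_mul_cancel]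
      rcases hP.mem_or_inv_mem hmem (fun h => hne (inv_mul_eq_one.mp h)) with h | h
      · exact hab.2 h
      · exact hba.2 (by simpa using h)
    · rintro a (h | h)
      · exact hr.irrefl _ h
      · exact hP.one_notMem (by simpa using h)
    · rintro a b c (h | h) (h' | h')
      · exact Or.inl (hr.trans _ _ _ h h')
      · exact Or.inl (hfP h' ▸ h)
      · exact Or.inl (hfP h ▸ h')
      · exact Or.inr (by simpa [mul_assoc] using hP.mul_mem h h')
  · rintro h a b (hab | hab)
    · exact Or.inl (by simpa using hinv (f h) _ _ hab)
    · exact Or.inr (by simpa [mul_assoc] using hab)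

open Classical in
/-- The sign of an element with respect to a positive cone. -/
noncomputable def coneSign {E : Type*} [Group E] (P : Set E) (x : E) : ℤ :=
  if x ∈ P then 1 else if x⁻¹ ∈ P then -1 else 0

theorem IsPositiveCone.isCircularlyOrderable {E K : Type*} [Group E] [Group K] (f : E →* K)
    {P : Set E} (hP : IsPositiveCone f.ker P) (hK : IsCircularlyOrderable K) :
    IsCircularlyOrderable E := by
  obtain ⟨c, hval, hzero, hcoc, hinv⟩ := hK
  have key : ∀ g₁ g₂ g₃ : E,
      let d := c (f g₁) (f g₂) (f g₃) + coneSign P (g₁⁻¹ * g₂) + coneSign P (g₂⁻¹ * g₃)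
        - coneSign P (g₁⁻¹ * g₃)
      (d = -1 ∨ d = 0 ∨ d = 1) ∧ (d = 0 ↔ g₁ = g₂ ∨ g₁ = g₃ ∨ g₂ = g₃) := by
    intro g₁ g₂ g₃ d
    have hker : ∀ {a b : E}, a⁻¹ * b ∈ f.ker ↔ f a = f b := by
      intro a b
      rw [MonoidHom.mem_ker, map_mul, map_inv, inv_mul_eq_one]
    have hsign : ∀ a b : E, (a = b ∧ coneSign P (a⁻¹ * b) = 0) ∨
        (f a ≠ f b ∧ a ≠ b ∧ coneSign P (a⁻¹ * b) = 0) ∨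
        (f a = f b ∧ a ≠ b ∧ a⁻¹ * b ∈ P ∧ coneSign P (a⁻¹ * b) = 1) ∨
        (f a = f b ∧ a ≠ b ∧ b⁻¹ * a ∈ P ∧ coneSign P (a⁻¹ * b) = -1) := by
      intro a b
      have hab : (a⁻¹ * b)⁻¹ = b⁻¹ * a := by simp
      unfold coneSign
      rw [hab]
      by_cases hne : a = b
      · subst hne
        left
        simp [hP.one_notMem]
      · by_cases hf : f a = f b
        · right; right
          have h1 : a⁻¹ * b ≠ 1 := fun h => hne (inv_mul_eq_one.mp h)
          rcases hP.mem_or_inv_mem (hker.mpr hf) h1 with h | h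
          · left; simp [h, hf, hne]
          · have h2 := hP.inv_notMem h
            rw [inv_inv] at h2
            rw [hab] at h
            right; simp [h, hf, hne, h2]
        · right; left
          have h1 : a⁻¹ * b ∉ P := fun h => hf (hker.mp (hP.subset h))
          have h2 : b⁻¹ * a ∉ P := fun h => hf (hker.mp (hP.subset h)).symm
          simp [h1, h2, hf, hne]
    have hval' := hval (f g₁) (f g₂) (f g₃)
    have hzero' := hzero (f g₁) (f g₂) (f g₃)
    have htrans : ∀ a b e : E, a⁻¹ * b ∈ P → b⁻¹ * e ∈ P → e⁻¹ * a ∉ P := by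
      intro a b e h h' h''
      exact hP.one_notMem (by simpa [mul_assoc] using hP.mul_mem (hP.mul_mem h h') h'')
    have hanti : ∀ a b : E, a⁻¹ * b ∈ P → b⁻¹ * a ∉ P := by
      intro a b h
      simpa using hP.inv_notMem h
    have a12 := hanti g₁ g₂
    have a13 := hanti g₁ g₃
    have a23 := hanti g₂ g₃
    have t1 := htrans g₁ g₂ g₃
    have t2 := htrans g₂ g₁ g₃
    have e12 : g₁ = g₂ → f g₁ = f g₂ := congrArg f
    have e13 : g₁ = g₃ → f g₁ = f g₃ := congrArg f
    have e23 : g₂ = g₃ → f g₂ = f g₃ := congrArg f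
    have hd : d = c (f g₁) (f g₂) (f g₃) + coneSign P (g₁⁻¹ * g₂) + coneSign P (g₂⁻¹ * g₃)
        - coneSign P (g₁⁻¹ * g₃) := rfl
    clear_value d
    have s12 := hsign g₁ g₂
    have s13 := hsign g₁ g₃
    have s23 := hsign g₂ g₃
    clear hsign hval hzero hcoc hinv htrans hanti
    generalize coneSign P (g₁⁻¹ * g₂) = x at *
    generalize coneSign P (g₂⁻¹ * g₃) = y at *
    generalize coneSign P (g₁⁻¹ * g₃) = z at *
    generalize c (f g₁) (f g₂) (f g₃) = w at *
    rcases s12 with h | h | h | h <;> rcases s13 with h' | h' | h' | h' <;>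
      rcases s23 with h'' | h'' | h'' | h'' <;> grind
  refine ⟨fun g₁ g₂ g₃ => c (f g₁) (f g₂) (f g₃) + coneSign P (g₁⁻¹ * g₂)
      + coneSign P (g₂⁻¹ * g₃) - coneSign P (g₁⁻¹ * g₃),
    fun g₁ g₂ g₃ => (key g₁ g₂ g₃).1, fun g₁ g₂ g₃ => (key g₁ g₂ g₃).2, ?_, ?_⟩
  · intro g₁ g₂ g₃ g₄
    linarith [hcoc (f g₁) (f g₂) (f g₃) (f g₄)]
  · intro h g₁ g₂ g₃
    have hmul : ∀ a b : E, (h * a)⁻¹ * (h * b) = a⁻¹ * b := by intro a b; group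
    simp only [hmul, map_mul, ← hinv (f h)]

/-! ### The exterior square -/

namespace ExteriorSquare

open scoped commutatorElement

variable {G : Type u} [Group G]

/-- The generator `g ∧ h` of the exterior square. -/
noncomputable def wedge (g h : G) : ExteriorSquare G :=
  QuotientGroup.mk' (Subgroup.normalClosure {t : TensorSquare G | ∃ g : G, t = tmul g g})
    (tmul g h)

theorem tmul_mul_left (g h k : G) :
    tmul (g * h) k = tmul (g * h * g⁻¹) (g * k * g⁻¹) * tmul g k := by
  have h1 : PresentedGroup.mk (tensorSquareRels G) (FreeGroup.of (g * h, k) *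
      (FreeGroup.of (g * h * g⁻¹, g * k * g⁻¹) * FreeGroup.of (g, k))⁻¹) = 1 :=
    PresentedGroup.one_of_mem ⟨g, h, k, Or.inl rfl⟩
  rw [map_mul, map_inv, mul_inv_eq_one, map_mul] at h1
  exact h1

theorem tmul_mul_right (g h k : G) :
    tmul g (h * k) = tmul g h * tmul (h * g * h⁻¹) (h * k * h⁻¹) := by
  have h1 : PresentedGroup.mk (tensorSquareRels G) (FreeGroup.of (g, h * k) *
      (FreeGroup.of (g, h) * FreeGroup.of (h * g * h⁻¹, h * k * h⁻¹))⁻¹) = 1 :=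
    PresentedGroup.one_of_mem ⟨g, h, k, Or.inr rfl⟩
  rw [map_mul, map_inv, mul_inv_eq_one, map_mul] at h1
  exact h1

theorem wedge_mul_left (g h k : G) :
    wedge (g * h) k = wedge (g * h * g⁻¹) (g * k * g⁻¹) * wedge g k := by
  simp only [wedge]
  rw [tmul_mul_left]
  exact map_mul _ _ _

theorem wedge_mul_right (g h k : G) :
    wedge g (h * k) = wedge g h * wedge (h * g * h⁻¹) (h * k * h⁻¹) := by
  simp only [wedge]
  rw [tmul_mul_right]
  exact map_mul _ _ _

theorem wedge_self (g : G) : wedge g g = 1 :=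
  (QuotientGroup.eq_one_iff _).mpr (Subgroup.subset_normalClosure ⟨g, rfl⟩)

theorem closure_range_wedge :
    Subgroup.closure (Set.range fun p : G × G => wedge p.1 p.2) = ⊤ := by
  have h1 : (Set.range fun p : G × G => wedge p.1 p.2) =
      QuotientGroup.mk' (Subgroup.normalClosure {t : TensorSquare G | ∃ g : G, t = tmul g g}) ''
        Set.range (PresentedGroup.of (rels := tensorSquareRels G)) := by
    exact Set.range_comp _ _
  have h2 := PresentedGroup.closure_range_of (tensorSquareRels G)
  rw [h1]
  refine (MonoidHom.map_closure _ _).symm.trans ?_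
  refine (congrArg _ h2).trans ?_
  exact Subgroup.map_top_of_surjective _ (QuotientGroup.mk'_surjective _)

@[elab_as_elim]
theorem induction_on {C : ExteriorSquare G → Prop} (m : ExteriorSquare G)
    (wedge : ∀ g h, C (wedge g h)) (one : C 1) (mul : ∀ a b, C a → C b → C (a * b))
    (inv : ∀ a, C a → C a⁻¹) : C m := by
  have hm : m ∈ Subgroup.closure (Set.range fun p : G × G => ExteriorSquare.wedge p.1 p.2) := by
    rw [closure_range_wedge]
    trivial
  induction hm using Subgroup.closure_induction with
  | mem x hx =>
    obtain ⟨p, rfl⟩ := hx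
    exact wedge _ _
  | one => exact one
  | mul x y _ _ hx hy => exact mul _ _ hx hy
  | inv x _ hx => exact inv _ hx

theorem hom_ext {H : Type*} [Group H] {φ ψ : ExteriorSquare G →* H}
    (h : ∀ g k, φ (wedge g k) = ψ (wedge g k)) : φ = ψ := by
  ext m
  induction m using induction_on with
  | wedge g k => exact h g k
  | one => simp
  | mul a b ha hb => simp [ha, hb]
  | inv a ha => simp [ha]

/-- The universal property of the exterior square. -/
noncomputable def lift {H : Type*} [Group H] (p : G → G → H)
    (hl : ∀ g h k, p (g * h) k = p (g * h * g⁻¹) (g * k * g⁻¹) * p g k)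
    (hr : ∀ g h k, p g (h * k) = p g h * p (h * g * h⁻¹) (h * k * h⁻¹))
    (hs : ∀ g, p g g = 1) : ExteriorSquare G →* H :=
  have hrel : ∀ r ∈ tensorSquareRels G, FreeGroup.lift (fun q : G × G => p q.1 q.2) r = 1 := by
    rintro r ⟨g, h, k, rfl | rfl⟩
    · simp only [map_mul, map_inv, FreeGroup.lift_apply_of, mul_inv_eq_one]
      exact hl g h k
    · simp only [map_mul, map_inv, FreeGroup.lift_apply_of, mul_inv_eq_one]
      exact hr g h k
  let φ : TensorSquare G →* H := PresentedGroup.toGroup hrel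
  QuotientGroup.lift _ φ (by
    have hφ : ∀ g h, φ (tmul g h) = p g h := fun g h => PresentedGroup.toGroup.of hrel
    have hle : Subgroup.normalClosure {t : TensorSquare G | ∃ g : G, t = tmul g g} ≤ φ.ker := by
      apply Subgroup.normalClosure_le_normal
      rintro t ⟨g, rfl⟩
      exact (hφ g g).trans (hs g)
    exact fun x hx => hle hx)

@[simp]
theorem lift_wedge {H : Type*} [Group H] (p : G → G → H)
    (hl : ∀ g h k, p (g * h) k = p (g * h * g⁻¹) (g * k * g⁻¹) * p g k)
    (hr : ∀ g h k, p g (h * k) = p g h * p (h * g * h⁻¹) (h * k * h⁻¹))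
    (hs : ∀ g, p g g = 1) (g h : G) : lift p hl hr hs (wedge g h) = p g h := by
  have hrel : ∀ r ∈ tensorSquareRels G, FreeGroup.lift (fun q : G × G => p q.1 q.2) r = 1 := by
    rintro r ⟨g, h, k, rfl | rfl⟩
    · simp only [map_mul, map_inv, FreeGroup.lift_apply_of, mul_inv_eq_one]
      exact hl g h k
    · simp only [map_mul, map_inv, FreeGroup.lift_apply_of, mul_inv_eq_one]
      exact hr g h k
  exact PresentedGroup.toGroup.of hrel

/-- The commutator pairing of a central extension `π : K → G`, as a homomorphism
`g ∧ h ↦ ⁅g', h'⁆` where `g'` and `h'` are lifts of `g` and `h`. -/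
theorem exists_hom_commutator {K : Type*} [Group K] (π : K →* G) (hπ : Function.Surjective π)
    (hcent : π.ker ≤ Subgroup.center K) :
    ∃ φ : ExteriorSquare G →* K, ∀ a b : K, φ (wedge (π a) (π b)) = ⁅a, b⁆ := by
  let σ := Function.surjInv hπ
  have hσ : ∀ g, π (σ g) = g := Function.surjInv_eq hπ
  have hcomm : ∀ a b : K, ⁅σ (π a), σ (π b)⁆ = ⁅a, b⁆ := by
    have hlift : ∀ a : K, ∃ z ∈ Subgroup.center K, σ (π a) = a * z := fun a =>
      ⟨a⁻¹ * σ (π a), hcent (by rw [MonoidHom.mem_ker, map_mul, map_inv, hσ, inv_mul_cancel]),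
        by group⟩
    intro a b
    obtain ⟨z, hz, ha⟩ := hlift a
    obtain ⟨w, hw, hb⟩ := hlift b
    rw [Subgroup.mem_center_iff] at hz hw
    rw [ha, hb, commutatorElement_def, commutatorElement_def]
    calc a * z * (b * w) * (a * z)⁻¹ * (b * w)⁻¹
        = a * (z * (b * w)) * z⁻¹ * a⁻¹ * w⁻¹ * b⁻¹ := by group
      _ = a * b * (w * a⁻¹) * w⁻¹ * b⁻¹ := by rw [← hz]; group
      _ = a * b * a⁻¹ * b⁻¹ := by rw [← hw]; group
  refine ⟨lift (fun g h => ⁅σ g, σ h⁆) ?_ ?_ ?_, fun a b => ?_⟩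
  · intro g h k
    obtain ⟨a, rfl⟩ := hπ g
    obtain ⟨b, rfl⟩ := hπ h
    obtain ⟨c, rfl⟩ := hπ k
    simp only [← map_mul, ← map_inv, hcomm, commutatorElement_def]
    group
  · intro g h k
    obtain ⟨a, rfl⟩ := hπ g
    obtain ⟨b, rfl⟩ := hπ h
    obtain ⟨c, rfl⟩ := hπ k
    simp only [← map_mul, ← map_inv, hcomm, commutatorElement_def]
    group
  · intro g
    exact commutatorElement_self _
  · rw [lift_wedge, hcomm]

/-- The homomorphism `G ∧ G → G` sending `g ∧ h` to `⁅g, h⁆`. -/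
noncomputable def commutatorHom : ExteriorSquare G →* G :=
  lift (fun g h => ⁅g, h⁆) (fun g h k => by simp only [commutatorElement_def]; group)
    (fun g h k => by simp only [commutatorElement_def]; group) commutatorElement_self

@[simp]
theorem commutatorHom_wedge (g h : G) : commutatorHom (wedge g h) = ⁅g, h⁆ :=
  lift_wedge _ _ _ _ _ _

/-- The action of `G` on its exterior square induced by conjugation. -/
noncomputable def act (x : G) : ExteriorSquare G →* ExteriorSquare G :=
  lift (fun g h => wedge (x * g * x⁻¹) (x * h * x⁻¹))
    (fun g h k => by
      have := wedge_mul_left (x * g * x⁻¹) (x * h * x⁻¹) (x * k * x⁻¹)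
      convert this using 2 <;> group)
    (fun g h k => by
      have := wedge_mul_right (x * g * x⁻¹) (x * h * x⁻¹) (x * k * x⁻¹)
      convert this using 2 <;> group)
    (fun g => wedge_self _)

@[simp]
theorem act_wedge (x g h : G) : act x (wedge g h) = wedge (x * g * x⁻¹) (x * h * x⁻¹) :=
  lift_wedge _ _ _ _ _ _

theorem act_one (m : ExteriorSquare G) : act (1 : G) m = m := by
  have : act (1 : G) = MonoidHom.id _ := hom_ext fun g h => by simp
  rw [this, MonoidHom.id_apply]

theorem act_act (x y : G) (m : ExteriorSquare G) : act x (act y m) = act (x * y) m := by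
  have : (act x).comp (act y) = act (x * y) := hom_ext fun g h => by simp [mul_assoc]
  exact DFunLike.congr_fun this m

theorem wedge_mul_left' (g h k : G) : wedge (g * h) k = act g (wedge h k) * wedge g k := by
  rw [wedge_mul_left, act_wedge]

theorem wedge_mul_right' (g h k : G) : wedge g (h * k) = wedge g h * act h (wedge g k) := by
  rw [wedge_mul_right, act_wedge]

@[simp]
theorem wedge_one_left (g : G) : wedge 1 g = 1 := by
  have := wedge_mul_left' 1 1 g
  rw [act_one, mul_one] at this
  exact left_eq_mul.mp this

@[simp]
theorem wedge_one_right (g : G) : wedge g 1 = 1 := by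
  have := wedge_mul_right' g 1 1
  rw [act_one, mul_one] at this
  exact left_eq_mul.mp this

theorem act_injective (x : G) : Function.Injective (act x) := by
  intro m n h
  have := congrArg (act x⁻¹) h
  simpa [act_act, act_one] using this

theorem wedge_mul_wedge_swap (g h : G) : wedge g h * wedge h g = 1 := by
  have h1 := wedge_self (h * g)
  rw [wedge_mul_left', wedge_mul_right' g, wedge_mul_right' h, wedge_self, wedge_self, map_one,
    mul_one, one_mul, ← map_mul] at h1
  exact act_injective h (h1.trans (map_one _).symm)

theorem wedge_swap (g h : G) : wedge h g = (wedge g h)⁻¹ :=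
  (inv_eq_of_mul_eq_one_right (wedge_mul_wedge_swap g h)).symm

/-- The Peiffer identity for generators. -/
theorem wedge_conj_wedge (g k a b : G) :
    wedge g k * wedge a b * (wedge g k)⁻¹ = act ⁅g, k⁆ (wedge a b) := by
  -- comparing the two expansions of `g * h ∧ k * l`
  have key : ∀ h l : G, act (g * k) (wedge h l) * wedge g k
      = wedge g k * act (k * g) (wedge h l) := by
    intro h l
    have h1 : wedge (g * h) (k * l) = act g (wedge h k) * act (g * k) (wedge h l)
        * (wedge g k * act k (wedge g l)) := by
      rw [wedge_mul_left', wedge_mul_right' h, wedge_mul_right' g, map_mul, act_act]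
    have h2 : wedge (g * h) (k * l) = act g (wedge h k) * wedge g k
        * (act (k * g) (wedge h l) * act k (wedge g l)) := by
      rw [wedge_mul_right', wedge_mul_left' g h k, wedge_mul_left' g h l, map_mul, act_act]
    have h3 := h1.symm.trans h2
    simp only [mul_assoc] at h3
    have h4 := mul_left_cancel h3
    simp only [← mul_assoc] at h4
    exact mul_right_cancel h4
  have h := key ((k * g)⁻¹ * a * (k * g)) ((k * g)⁻¹ * b * (k * g))
  have e : act (k * g) (wedge ((k * g)⁻¹ * a * (k * g)) ((k * g)⁻¹ * b * (k * g)))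
      = wedge a b := by
    rw [act_wedge]
    congr 1 <;> group
  have e2 : act (g * k) (wedge ((k * g)⁻¹ * a * (k * g)) ((k * g)⁻¹ * b * (k * g)))
      = act ⁅g, k⁆ (wedge a b) := by
    rw [← e, act_act, commutatorElement_def]
    congr 2
    group
  rw [e, e2] at h
  rw [← h, mul_inv_cancel_right]

theorem act_commutator (g k : G) (m : ExteriorSquare G) :
    act ⁅g, k⁆ m = wedge g k * m * (wedge g k)⁻¹ := by
  have : act ⁅g, k⁆ = (MulAut.conj (wedge g k)).toMonoidHom := hom_ext fun a b => by
    rw [← wedge_conj_wedge]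
    simp
  rw [this]
  simp

/-- The Peiffer identity. -/
theorem act_commutatorHom (m n : ExteriorSquare G) :
    act (commutatorHom m) n = m * n * m⁻¹ := by
  induction m using induction_on generalizing n with
  | wedge g k => rw [commutatorHom_wedge, act_commutator]
  | one => simp [act_one]
  | mul a b ha hb => rw [map_mul, ← act_act, hb, ha]; group
  | inv a ha =>
    apply act_injective (commutatorHom a)
    rw [act_act, ha]
    simp [act_one, mul_assoc]

theorem wedge_commutator_left (g h k : G) :
    wedge ⁅g, h⁆ k = wedge g h * (act k (wedge g h))⁻¹ := by
  obtain ⟨u, hu⟩ : ∃ u, u = h⁻¹ * k * h := ⟨_, rfl⟩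
  have hk : h * u = k * h := by rw [hu]; group
  have h1 : act h (wedge g u) = (wedge g h)⁻¹ * (wedge g k * act k (wedge g h)) := by
    rw [← wedge_mul_right' g k h, ← hk, wedge_mul_right', inv_mul_cancel_left]
  have h2 : act (g * h * g⁻¹) (wedge g u)
      = wedge g k * act k (wedge g h) * (wedge g h)⁻¹ := by
    have : g * h * g⁻¹ = ⁅g, h⁆ * h := by rw [commutatorElement_def]; group
    rw [this, ← act_act, h1, act_commutator]
    group
  have h3 : wedge g⁻¹ u = (act g⁻¹ (wedge g u))⁻¹ := by
    have := wedge_mul_left' g⁻¹ g u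
    rw [inv_mul_cancel, wedge_one_left] at this
    exact (inv_eq_of_mul_eq_one_right this.symm).symm
  have h4 : wedge (h * g⁻¹ * h⁻¹) k = act h (wedge g⁻¹ u) := by
    rw [act_wedge]
    congr 1
    rw [hu]
    group
  have h5 : ⁅g, h⁆ = g * (h * g⁻¹ * h⁻¹) := by rw [commutatorElement_def]; group
  rw [h5, wedge_mul_left', h4, h3, map_inv, map_inv, act_act, act_act, h2]
  group

theorem act_wedge_mul_wedge (x y a b : G) :
    act x (wedge y a) * wedge x (a * y * b) = wedge x (y * a * b) * wedge y a := by
  have h1 : wedge x ⁅a, y⁆ = act x (wedge a y) * (wedge a y)⁻¹ := by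
    rw [wedge_swap, wedge_commutator_left, mul_inv_rev, inv_inv]
  have h2 : a * y * b = ⁅a, y⁆ * (y * a * b) := by rw [commutatorElement_def]; group
  rw [h2, wedge_mul_right', h1, act_commutator, wedge_swap a y, map_inv]
  group

theorem commute_of_mem_ker {m : ExteriorSquare G} (hm : m ∈ (commutatorHom (G := G)).ker)
    (n : ExteriorSquare G) : m * n = n * m := by
  have := act_commutatorHom m n
  rw [MonoidHom.mem_ker.mp hm, act_one] at this
  exact (eq_mul_inv_iff_mul_eq.mp this).symm

/-! ### Torsion in the kernel of the commutator homomorphism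

We construct permutations of `(G ∧ G) × (G →₀ ℤ)`, indexed by the elements of `G`, whose
commutators are the translations by the elements `g ∧ h`. -/

section Monodromy

theorem _root_.List.prod_map_filter_of_eq_one {α M : Type*} [Monoid M] (l : List α)
    (p : α → Bool) (f : α → M) (h : ∀ a ∈ l, p a = false → f a = 1) :
    ((l.filter p).map f).prod = (l.map f).prod := by
  induction l with
  | nil => rfl
  | cons a l ih =>
    have ih' := ih fun b hb => h b (List.mem_cons_of_mem _ hb)
    cases hp : p a with
    | true => simp [hp, ih']
    | false => simp [hp, ih', h a List.mem_cons_self hp]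

/-- Translation of `(G ∧ G) × (G →₀ ℤ)` by an element of `G ∧ G`. -/
noncomputable def translation :
    ExteriorSquare G →* Equiv.Perm (ExteriorSquare G × (G →₀ ℤ)) where
  toFun m := (Equiv.mulLeft m).prodCongr (Equiv.refl _)
  map_one' := by ext p <;> simp
  map_mul' a b := by ext p <;> simp [mul_assoc]

theorem translation_apply (m : ExteriorSquare G) (p : ExteriorSquare G × (G →₀ ℤ)) :
    translation m p = (m * p.1, p.2) := rfl

theorem translation_injective : Function.Injective (translation (G := G)) := by
  intro a b h
  have := congrArg Prod.fst (DFunLike.congr_fun h (1, 0))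
  simpa [translation_apply] using this

variable [LinearOrder G]

/-- The increasing product of the elements `y ^ n y` over all `y < x`. -/
def orderedProd (x : G) (n : G →₀ ℤ) : G :=
  (n.support.sort.map fun y => if y < x then y ^ n y else 1).prod

theorem orderedProd_eq (x : G) {n : G →₀ ℤ} {T : Finset G} (hT : n.support ⊆ T) :
    orderedProd x n = (T.sort.map fun y => if y < x then y ^ n y else 1).prod := by
  have hsort : n.support.sort = T.sort.filter (· ∈ n.support) := by
    have hset : (T.sort.filter (· ∈ n.support)).toFinset = n.support := by
      ext a
      simpa using fun h => hT (Finsupp.mem_support_iff.mpr h)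
    have hsorted := (List.toFinset_sort (r := (· ≤ ·))
      ((T.sort_nodup (· ≤ ·)).filter (· ∈ n.support))).mpr
        ((T.pairwise_sort (· ≤ ·)).filter (· ∈ n.support))
    rw [hset] at hsorted
    exact hsorted
  rw [orderedProd, hsort]
  apply List.prod_map_filter_of_eq_one
  intro a _ ha
  have : n a = 0 := by simpa using ha
  simp [this]

theorem orderedProd_add_single_of_le {x y : G} (h : y ≤ x) (n : G →₀ ℤ) :
    orderedProd y (n + Finsupp.single x 1) = orderedProd y n := by
  classical
  rw [orderedProd_eq y (n := n + Finsupp.single x 1)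
      (Finset.subset_union_right (s₁ := n.support)),
    orderedProd_eq y (n := n) (Finset.subset_union_left)]
  congr 1
  apply List.map_congr_left
  intro z _
  split_ifs with hz
  · have : z ≠ x := (hz.trans_le h).ne
    simp [this.symm]
  · rfl

theorem exists_orderedProd_add_single {x y : G} (h : y < x) (n : G →₀ ℤ) :
    ∃ b, orderedProd x n = orderedProd y n * b ∧
      orderedProd x (n + Finsupp.single y 1) = orderedProd y n * y * b := by
  classical
  obtain ⟨T, hT⟩ : ∃ T, T = insert y (n.support ∪ (n + Finsupp.single y 1).support) := ⟨_, rfl⟩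
  have h1 : n.support ⊆ T := by
    rw [hT]
    exact Finset.subset_union_left.trans (Finset.subset_insert _ _)
  have h2 : (n + Finsupp.single y 1).support ⊆ T := by
    rw [hT]
    exact Finset.subset_union_right.trans (Finset.subset_insert _ _)
  have hy : y ∈ T.sort := by simp [hT]
  obtain ⟨l₁, l₂, hl⟩ := List.append_of_mem hy
  have hsorted := T.sortedLT_sort.pairwise
  rw [hl, List.pairwise_append, List.pairwise_cons] at hsorted
  obtain ⟨-, ⟨hl₂, -⟩, hl₁⟩ := hsorted
  replace hl₁ : ∀ z ∈ l₁, z < y := fun z hz => hl₁ z hz y List.mem_cons_self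
  have e1 : orderedProd y n = (l₁.map fun z => z ^ n z).prod := by
    have hr : (l₂.map fun z => if z < y then z ^ n z else 1).prod = 1 := by
      apply List.prod_eq_one
      simp only [List.mem_map]
      rintro _ ⟨z, hz, rfl⟩
      rw [if_neg (hl₂ z hz).not_gt]
    have hm : (l₁.map fun z => if z < y then z ^ n z else 1) = l₁.map fun z => z ^ n z :=
      List.map_congr_left fun z hz => if_pos (hl₁ z hz)
    rw [orderedProd_eq y h1, hl, List.map_append, List.map_cons, List.prod_append,
      List.prod_cons, hr, hm, if_neg (lt_irrefl y), one_mul, mul_one]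
  refine ⟨y ^ n y * (l₂.map fun z => if z < x then z ^ n z else 1).prod, ?_, ?_⟩
  · have hm : (l₁.map fun z => if z < x then z ^ n z else 1) = l₁.map fun z => z ^ n z :=
      List.map_congr_left fun z hz => if_pos ((hl₁ z hz).trans h)
    rw [orderedProd_eq x h1, hl, List.map_append, List.map_cons, List.prod_append,
      List.prod_cons, hm, if_pos h, e1]
  · have hm : (l₁.map fun z => if z < x then z ^ (n + Finsupp.single y 1 : G →₀ ℤ) z else 1)
        = l₁.map fun z => z ^ n z :=
      List.map_congr_left fun z hz => by
        simp [(hl₁ z hz).trans h, (hl₁ z hz).ne']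
    have hm₂ : (l₂.map fun z => if z < x then z ^ (n + Finsupp.single y 1 : G →₀ ℤ) z else 1)
        = l₂.map fun z => if z < x then z ^ n z else 1 :=
      List.map_congr_left fun z hz => by
        simp [(hl₂ z hz).ne]
    have hp : y ^ (n + Finsupp.single y 1 : G →₀ ℤ) y = y * y ^ n y := by
      rw [Finsupp.add_apply, Finsupp.single_eq_same, add_comm, zpow_add, zpow_one]
    rw [orderedProd_eq x h2, hl, List.map_append, List.map_cons, List.prod_append,
      List.prod_cons, hm, hm₂, if_pos h, e1, hp]
    simp only [mul_assoc]

/-- The permutation of `(G ∧ G) × (G →₀ ℤ)` attached to an element of `G`. -/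
noncomputable def shift (x : G) : Equiv.Perm (ExteriorSquare G × (G →₀ ℤ)) where
  toFun p := (act x p.1 * wedge x (orderedProd x p.2), p.2 + Finsupp.single x 1)
  invFun p := (act x⁻¹ (p.1 * (wedge x (orderedProd x (p.2 - Finsupp.single x 1)))⁻¹),
    p.2 - Finsupp.single x 1)
  left_inv p := by
    simp only [add_sub_cancel_right, mul_inv_cancel_right, act_act, inv_mul_cancel, act_one]
  right_inv p := by
    simp only [sub_add_cancel, inv_mul_cancel_right, act_act, mul_inv_cancel, act_one]

theorem shift_apply (x : G) (p : ExteriorSquare G × (G →₀ ℤ)) :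
    shift x p = (act x p.1 * wedge x (orderedProd x p.2), p.2 + Finsupp.single x 1) := rfl

theorem shift_mul_translation (x : G) (m : ExteriorSquare G) :
    shift x * translation m = translation (act x m) * shift x := by
  apply Equiv.ext
  intro p
  simp only [Equiv.Perm.mul_apply, shift_apply, translation_apply, map_mul, mul_assoc]

theorem commutator_shift_of_lt {x y : G} (h : y < x) :
    ⁅shift x, shift y⁆ = translation (wedge x y) := by
  have key : shift x * shift y = translation (wedge x y) * (shift y * shift x) := by
    apply Equiv.ext
    rintro ⟨m, n⟩
    obtain ⟨b, hb, hb'⟩ := exists_orderedProd_add_single h n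
    simp only [Equiv.Perm.mul_apply, shift_apply, translation_apply, map_mul]
    rw [orderedProd_add_single_of_le h.le, hb, hb', add_right_comm n]
    refine Prod.ext ?_ rfl
    have h1 := act_wedge_mul_wedge x y (orderedProd y n) b
    have h2 : act (x * y) m * wedge x y = wedge x y * act (y * x) m := by
      have : x * y = ⁅x, y⁆ * (y * x) := by rw [commutatorElement_def]; group
      rw [this, ← act_act, act_commutator, inv_mul_cancel_right]
    have h3 := wedge_mul_right' x y (orderedProd y n * b)
    simp only [act_act, mul_assoc] at h1 h2 h3 ⊢
    rw [h1, h3]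
    simp only [← mul_assoc]
    rw [h2]
  rw [commutatorElement_def, key]
  group

theorem commutator_shift (x y : G) : ⁅shift x, shift y⁆ = translation (wedge x y) := by
  rcases lt_trichotomy x y with h | rfl | h
  · rw [← commutatorElement_inv, commutator_shift_of_lt h, ← map_inv, ← wedge_swap]
  · rw [commutatorElement_self, wedge_self, map_one]
  · exact commutator_shift_of_lt h

theorem lift_shift_conj_translation (u : FreeGroup G) (m : ExteriorSquare G) :
    FreeGroup.lift shift u * translation m * (FreeGroup.lift shift u)⁻¹
      = translation (act (FreeGroup.lift id u) m) := by
  induction u using FreeGroup.induction_on generalizing m with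
  | C1 => simp [act_one]
  | of x =>
    rw [FreeGroup.lift_apply_of, FreeGroup.lift_apply_of, shift_mul_translation,
      mul_inv_cancel_right, id]
  | inv_of x _ =>
    rw [map_inv, map_inv, FreeGroup.lift_apply_of, FreeGroup.lift_apply_of, id, inv_inv,
      mul_assoc, inv_mul_eq_iff_eq_mul, ← mul_one (translation m * shift x)]
    have := shift_mul_translation x (act x⁻¹ m)
    rw [act_act, mul_inv_cancel, act_one] at this
    rw [mul_one, this]
  | mul u v hu hv =>
    rw [map_mul, map_mul, ← act_act, ← hu, ← hv]
    group

theorem commutator_lift_shift (u v : FreeGroup G) :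
    ⁅FreeGroup.lift shift u, FreeGroup.lift shift v⁆
      = translation (wedge (FreeGroup.lift id u) (FreeGroup.lift id v)) := by
  have mul_left : ∀ a b v : FreeGroup G,
      ⁅FreeGroup.lift shift a, FreeGroup.lift shift v⁆
        = translation (wedge (FreeGroup.lift id a) (FreeGroup.lift id v)) →
      ⁅FreeGroup.lift shift b, FreeGroup.lift shift v⁆
        = translation (wedge (FreeGroup.lift id b) (FreeGroup.lift id v)) →
      ⁅FreeGroup.lift shift (a * b), FreeGroup.lift shift v⁆
        = translation (wedge (FreeGroup.lift id (a * b)) (FreeGroup.lift id v)) := by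
    intro a b v ha hb
    rw [map_mul (FreeGroup.lift (id : G → G)), wedge_mul_left', map_mul translation,
      ← lift_shift_conj_translation, ← ha, ← hb, map_mul]
    simp only [commutatorElement_def]
    group
  have inv_left : ∀ a v : FreeGroup G,
      ⁅FreeGroup.lift shift a, FreeGroup.lift shift v⁆
        = translation (wedge (FreeGroup.lift id a) (FreeGroup.lift id v)) →
      ⁅FreeGroup.lift shift a⁻¹, FreeGroup.lift shift v⁆
        = translation (wedge (FreeGroup.lift id a⁻¹) (FreeGroup.lift id v)) := by
    intro a v ha
    have h1 := wedge_mul_left' (FreeGroup.lift id a)⁻¹ (FreeGroup.lift id a)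
      (FreeGroup.lift id v)
    rw [inv_mul_cancel, wedge_one_left] at h1
    rw [map_inv (FreeGroup.lift (id : G → G)), ← inv_eq_of_mul_eq_one_right h1.symm,
      map_inv translation, ← map_inv (FreeGroup.lift (id : G → G)), ← lift_shift_conj_translation, ← ha, map_inv]
    simp only [commutatorElement_def]
    group
  have swap : ∀ a v : FreeGroup G,
      ⁅FreeGroup.lift shift a, FreeGroup.lift shift v⁆
        = translation (wedge (FreeGroup.lift id a) (FreeGroup.lift id v)) →
      ⁅FreeGroup.lift shift v, FreeGroup.lift shift a⁆
        = translation (wedge (FreeGroup.lift id v) (FreeGroup.lift id a)) := by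
    intro a v h
    rw [← commutatorElement_inv, h, ← map_inv, ← wedge_swap]
  have of_left : ∀ (x : G) (v : FreeGroup G),
      ⁅FreeGroup.lift shift (FreeGroup.of x), FreeGroup.lift shift v⁆
        = translation (wedge (FreeGroup.lift id (FreeGroup.of x)) (FreeGroup.lift id v)) := by
    intro x v
    induction v using FreeGroup.induction_on with
    | C1 => simp
    | of y => simpa using commutator_shift x y
    | inv_of y hy => exact swap _ _ (inv_left _ _ (swap _ _ hy))
    | mul a b ha hb => exact swap _ _ (mul_left _ _ _ (swap _ _ ha) (swap _ _ hb))
  induction u using FreeGroup.induction_on with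
  | C1 => simp
  | of x => exact of_left x v
  | inv_of x hx => exact inv_left _ _ hx
  | mul a b ha hb => exact mul_left _ _ _ ha hb

end Monodromy

theorem mem_commutator_of_pow_mem (hH2 : ∀ a : H2 G, IsOfFinOrder a → a = 1) {f : FreeGroup G}
    (hf : f ∈ presKernel G ⊓ commutator (FreeGroup G)) {n : ℕ} (hn : 0 < n)
    (hfn : f ^ n ∈ ⁅(⊤ : Subgroup (FreeGroup G)), presKernel G⁆) :
    f ∈ ⁅(⊤ : Subgroup (FreeGroup G)), presKernel G⁆ := by
  have h : ∀ a : ↥(presKernel G ⊓ commutator (FreeGroup G)) ⧸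
      ((⁅(⊤ : Subgroup (FreeGroup G)), presKernel G⁆).subgroupOf
        (presKernel G ⊓ commutator (FreeGroup G))), IsOfFinOrder a → a = 1 := hH2
  have h1 := h (QuotientGroup.mk ⟨f, hf⟩) (by
    rw [isOfFinOrder_iff_pow_eq_one]
    refine ⟨n, hn, ?_⟩
    rw [← QuotientGroup.mk_pow, QuotientGroup.eq_one_iff]
    exact hfn)
  rw [QuotientGroup.eq_one_iff] at h1
  exact h1

/-- The kernel of `G ∧ G → G` embeds in `H₂(G)`; in particular it is torsion-free if `H₂(G)` is. -/
theorem eq_one_of_isOfFinOrder (hH2 : ∀ a : H2 G, IsOfFinOrder a → a = 1)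
    {m : ExteriorSquare G} (hm : m ∈ (commutatorHom (G := G)).ker) (hfin : IsOfFinOrder m) :
    m = 1 := by
  classical
  let _ : LinearOrder G := linearOrderOfSTO WellOrderingRel
  let C : Subgroup (FreeGroup G) := ⁅(⊤ : Subgroup (FreeGroup G)), presKernel G⁆
  have hC : C ≤ presKernel G := Subgroup.commutator_le_right _ _
  let π : FreeGroup G ⧸ C →* G := QuotientGroup.lift C (FreeGroup.lift id) hC
  have hπ_mk : ∀ f : FreeGroup G, π (QuotientGroup.mk' C f) = FreeGroup.lift id f := fun f => rfl
  have hπ : Function.Surjective π := fun g =>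
    ⟨QuotientGroup.mk' C (FreeGroup.of g), by rw [hπ_mk, FreeGroup.lift_apply_of, id]⟩
  have hcent : π.ker ≤ Subgroup.center (FreeGroup G ⧸ C) := by
    intro q hq
    obtain ⟨r, rfl⟩ := QuotientGroup.mk'_surjective C q
    rw [Subgroup.mem_center_iff]
    intro q'
    obtain ⟨f, rfl⟩ := QuotientGroup.mk'_surjective C q'
    rw [← commutatorElement_eq_one_iff_mul_comm, ← map_commutatorElement]
    exact (QuotientGroup.eq_one_iff _).mpr
      (Subgroup.commutator_mem_commutator (Subgroup.mem_top f) hq)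
  obtain ⟨φ, hφ⟩ := exists_hom_commutator π hπ hcent
  have hshift : C ≤ (FreeGroup.lift (shift (G := G))).ker := by
    rw [Subgroup.commutator_le]
    intro f _ r hr
    have hr' : FreeGroup.lift id r = 1 := hr
    rw [MonoidHom.mem_ker, map_commutatorElement, commutator_lift_shift, hr', wedge_one_right,
      map_one]
  let ρ := QuotientGroup.lift C (FreeGroup.lift (shift (G := G))) hshift
  have hφ_of : ∀ g k : G, φ (wedge g k)
      = QuotientGroup.mk' C ⁅FreeGroup.of g, FreeGroup.of k⁆ := by
    intro g k
    have := hφ (QuotientGroup.mk' C (FreeGroup.of g)) (QuotientGroup.mk' C (FreeGroup.of k))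
    rwa [hπ_mk, hπ_mk, FreeGroup.lift_apply_of, FreeGroup.lift_apply_of, id, id,
      ← map_commutatorElement] at this
  have hρφ : ρ.comp φ = translation := hom_ext fun g k => by
    rw [MonoidHom.comp_apply, hφ_of]
    change FreeGroup.lift shift ⁅FreeGroup.of g, FreeGroup.of k⁆ = _
    rw [map_commutatorElement, commutator_lift_shift, FreeGroup.lift_apply_of,
      FreeGroup.lift_apply_of, id, id]
  have hlift : ∃ f ∈ commutator (FreeGroup G), QuotientGroup.mk' C f = φ m ∧
      FreeGroup.lift id f = commutatorHom m := by
    clear hm hfin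
    induction m using induction_on with
    | wedge g k =>
      refine ⟨⁅FreeGroup.of g, FreeGroup.of k⁆, Subgroup.commutator_mem_commutator
        (Subgroup.mem_top _) (Subgroup.mem_top _), (hφ_of g k).symm, ?_⟩
      rw [map_commutatorElement, FreeGroup.lift_apply_of, FreeGroup.lift_apply_of,
        commutatorHom_wedge, id, id]
    | one => exact ⟨1, one_mem _, by simp, by simp⟩
    | mul a b ha hb =>
      obtain ⟨f, hf, hf1, hf2⟩ := ha
      obtain ⟨f', hf', hf1', hf2'⟩ := hb
      exact ⟨f * f', mul_mem hf hf', by rw [map_mul, map_mul, hf1, hf1'],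
        by rw [map_mul, map_mul, hf2, hf2']⟩
    | inv a ha =>
      obtain ⟨f, hf, hf1, hf2⟩ := ha
      exact ⟨f⁻¹, inv_mem hf, by rw [map_inv, map_inv, hf1], by rw [map_inv, map_inv, hf2]⟩
  obtain ⟨f, hf, hfφ, hfG⟩ := hlift
  obtain ⟨n, hn, hmn⟩ := isOfFinOrder_iff_pow_eq_one.mp hfin
  have hfR : f ∈ presKernel G := hfG.trans (MonoidHom.mem_ker.mp hm)
  have hfC : f ∈ C := mem_commutator_of_pow_mem hH2 ⟨hfR, hf⟩ hn (by
    rw [← QuotientGroup.eq_one_iff (N := C)]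
    change QuotientGroup.mk' C (f ^ n) = 1
    rw [map_pow, hfφ, ← map_pow, hmn, map_one])
  apply translation_injective
  rw [← hρφ, MonoidHom.comp_apply, ← hfφ, map_one]
  exact hshift hfC

end ExteriorSquare

/-- If `G` admits a central extension `1 → A → K → G → 1` with `K`
circularly orderable and `H₂(G)` is torsion-free, then the exterior square `G ∧ G` is
circularly orderable; if moreover `K` is left-orderable, then `G ∧ G` is left-orderable. -/
theorem exteriorSquare_orderable_of_central_extension
    (G : Type u) (A : Type v) (K : Type u) [Group G] [Group A] [Group K]
    (i : A →* K) (π : K →* G)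
    (hi : Function.Injective i) (hπ : Function.Surjective π)
    (hker : π.ker = i.range) (hcent : i.range ≤ Subgroup.center K)
    (hH2 : ∀ a : H2 G, IsOfFinOrder a → a = 1)
    (hK : IsCircularlyOrderable K) :
    IsCircularlyOrderable (ExteriorSquare G) ∧
      (IsLeftOrderable K → IsLeftOrderable (ExteriorSquare G)) := by
  have hcent' : π.ker ≤ Subgroup.center K := hker ▸ hcent
  obtain ⟨φ, hφ⟩ := ExteriorSquare.exists_hom_commutator π hπ hcent'
  have hcomp : π.comp φ = ExteriorSquare.commutatorHom := ExteriorSquare.hom_ext fun g h => by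
    obtain ⟨a, rfl⟩ := hπ g
    obtain ⟨b, rfl⟩ := hπ h
    rw [MonoidHom.comp_apply, hφ, map_commutatorElement, ExteriorSquare.commutatorHom_wedge]
  have hle : φ.ker ≤ (ExteriorSquare.commutatorHom (G := G)).ker := by
    intro m hm
    rw [MonoidHom.mem_ker, ← hcomp, MonoidHom.comp_apply, MonoidHom.mem_ker.mp hm, map_one]
  obtain ⟨P, hP⟩ := exists_isPositiveCone_of_torsionFree φ.ker
    (fun x hx y _ => ExteriorSquare.commute_of_mem_ker (hle hx) y)
    (fun x hx hfin => ExteriorSquare.eq_one_of_isOfFinOrder hH2 (hle hx) hfin)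
  exact ⟨hP.isCircularlyOrderable φ hK, hP.isLeftOrderable φ⟩
end

section
/- Let G be a circularly orderable group such that H₁(G) is a finitely generated free abelian group and H₂(G) is torsion-free. Then the nonabelian tensor square G ⊗ G is left-orderable. -/
universe u

namespace TensorSquare

variable {G : Type u} [Group G]

theorem mul_tmul (g h k : G) :
    tmul (g * h) k = tmul (g * h * g⁻¹) (g * k * g⁻¹) * tmul g k := by
  have h1 : PresentedGroup.mk (tensorSquareRels G) (FreeGroup.of (g * h, k) *
        (FreeGroup.of (g * h * g⁻¹, g * k * g⁻¹) * FreeGroup.of (g, k))⁻¹) = 1 :=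
    (QuotientGroup.eq_one_iff _).2 (Subgroup.subset_normalClosure ⟨g, h, k, Or.inl rfl⟩)
  rw [map_mul, map_inv, mul_inv_eq_one, map_mul] at h1
  exact h1

theorem tmul_mul (g h k : G) :
    tmul g (h * k) = tmul g h * tmul (h * g * h⁻¹) (h * k * h⁻¹) := by
  have h1 : PresentedGroup.mk (tensorSquareRels G) (FreeGroup.of (g, h * k) *
        (FreeGroup.of (g, h) * FreeGroup.of (h * g * h⁻¹, h * k * h⁻¹))⁻¹) = 1 :=
    (QuotientGroup.eq_one_iff _).2 (Subgroup.subset_normalClosure ⟨g, h, k, Or.inr rfl⟩)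
  rw [map_mul, map_inv, mul_inv_eq_one, map_mul] at h1
  exact h1

/-- The homomorphism out of `G ⊗ G` induced by a crossed pairing. -/
def lift {H : Type*} [Group H] (f : G → G → H)
    (hl : ∀ g h k, f (g * h) k = f (g * h * g⁻¹) (g * k * g⁻¹) * f g k)
    (hr : ∀ g h k, f g (h * k) = f g h * f (h * g * h⁻¹) (h * k * h⁻¹)) :
    TensorSquare G →* H :=
  PresentedGroup.toGroup (rels := tensorSquareRels G) (f := fun p => f p.1 p.2) (by
    rintro r ⟨g, h, k, rfl | rfl⟩
    · simp only [map_mul, map_inv, FreeGroup.lift_apply_of, hl g h k, mul_inv_cancel]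
    · simp only [map_mul, map_inv, FreeGroup.lift_apply_of, hr g h k, mul_inv_cancel])

@[simp]
theorem lift_tmul {H : Type*} [Group H] (f : G → G → H) (hl hr) (g h : G) :
    lift f hl hr (tmul g h) = f g h :=
  PresentedGroup.toGroup.of _

theorem closure_tmul : Subgroup.closure (Set.range fun p : G × G => tmul p.1 p.2) = ⊤ :=
  PresentedGroup.closure_range_of (tensorSquareRels G)

@[elab_as_elim]
theorem induction {p : TensorSquare G → Prop} (t : TensorSquare G)
    (tmul : ∀ a b, p (tmul a b)) (one : p 1) (mul : ∀ s t, p s → p t → p (s * t))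
    (inv : ∀ t, p t → p t⁻¹) : p t := by
  have ht : t ∈ Subgroup.closure (Set.range fun p : G × G => _root_.tmul p.1 p.2) := by
    rw [closure_tmul]; trivial
  induction ht using Subgroup.closure_induction with
  | mem x hx => obtain ⟨⟨a, b⟩, rfl⟩ := hx; exact tmul a b
  | one => exact one
  | mul x y _ _ hx hy => exact mul x y hx hy
  | inv x _ hx => exact inv x hx

theorem hom_ext {H : Type*} [Group H] {φ ψ : TensorSquare G →* H}
    (h : ∀ a b, φ (tmul a b) = ψ (tmul a b)) : φ = ψ :=
  PresentedGroup.ext (rels := tensorSquareRels G) fun x => h x.1 x.2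

@[simp]
theorem one_tmul (k : G) : tmul 1 k = 1 := by
  have := mul_tmul 1 1 k
  simpa using this

@[simp]
theorem tmul_one (k : G) : tmul k 1 = 1 := by
  have := tmul_mul k 1 1
  simpa using this

/-- The diagonal conjugation action of `G` on `G ⊗ G`. -/
def act (g : G) : TensorSquare G →* TensorSquare G :=
  lift (fun a b => tmul (g * a * g⁻¹) (g * b * g⁻¹))
    (fun a b c => by
      have := mul_tmul (g * a * g⁻¹) (g * b * g⁻¹) (g * c * g⁻¹)
      simpa only [mul_assoc, inv_mul_cancel_left, mul_inv_rev, inv_inv] using this)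
    (fun a b c => by
      have := tmul_mul (g * a * g⁻¹) (g * b * g⁻¹) (g * c * g⁻¹)
      simpa only [mul_assoc, inv_mul_cancel_left, mul_inv_rev, inv_inv] using this)

@[simp]
theorem act_tmul (g a b : G) : act g (tmul a b) = tmul (g * a * g⁻¹) (g * b * g⁻¹) :=
  lift_tmul _ _ _ _ _

theorem act_mul (g h : G) (t : TensorSquare G) : act (g * h) t = act g (act h t) := by
  have : act (g * h) = (act g).comp (act h) := hom_ext fun a b => by simp [mul_assoc]
  exact DFunLike.congr_fun this t

@[simp]
theorem act_one (t : TensorSquare G) : act 1 t = t := by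
  have : act (1 : G) = MonoidHom.id _ := hom_ext fun a b => by simp
  exact DFunLike.congr_fun this t

theorem mul_tmul' (g h k : G) : tmul (g * h) k = act g (tmul h k) * tmul g k := by
  rw [mul_tmul, act_tmul]

theorem tmul_mul' (g h k : G) : tmul g (h * k) = tmul g h * act h (tmul g k) := by
  rw [tmul_mul, act_tmul]

/-- The commutator homomorphism `G ⊗ G → G`. -/
def comm : TensorSquare G →* G :=
  lift (fun a b => a * b * a⁻¹ * b⁻¹) (fun _ _ _ => by group) (fun _ _ _ => by group)

@[simp]
theorem comm_tmul (a b : G) : comm (tmul a b) = a * b * a⁻¹ * b⁻¹ :=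
  lift_tmul _ _ _ _ _

theorem act_mul_tmul (a b : G) (s : TensorSquare G) :
    act (a * b) s * tmul a b = tmul a b * act (b * a) s := by
  induction s using induction with
  | tmul c d =>
    have h1 : tmul (a * c) (b * d) = act a (tmul c b) * act (a * b) (tmul c d) *
        (tmul a b * act b (tmul a d)) := by
      rw [mul_tmul', tmul_mul' c, tmul_mul' a, map_mul, ← act_mul]
    have h2 : tmul (a * c) (b * d) = act a (tmul c b) * tmul a b *
        (act (b * a) (tmul c d) * act b (tmul a d)) := by
      rw [tmul_mul', mul_tmul' a c b, mul_tmul' a c d, map_mul, ← act_mul]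
    rw [h1] at h2
    simp only [mul_assoc, mul_right_inj] at h2
    simp only [← mul_assoc, mul_left_inj] at h2
    exact h2
  | one => simp
  | mul s t hs ht => rw [map_mul, mul_assoc, ht, ← mul_assoc, hs, map_mul, mul_assoc]
  | inv t ht =>
    rw [map_inv, map_inv, inv_mul_eq_iff_eq_mul, ← mul_assoc, ht, mul_inv_cancel_right]

theorem act_comm (t s : TensorSquare G) : act (comm t) s = t * s * t⁻¹ := by
  induction t using induction generalizing s with
  | tmul a b =>
    have := act_mul_tmul a b (act (b * a)⁻¹ s)
    rw [← act_mul, ← act_mul, mul_inv_cancel, act_one] at this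
    rw [comm_tmul, eq_mul_inv_iff_mul_eq, ← this]
    simp [mul_assoc]
  | one => simp
  | mul t t' ht ht' => rw [map_mul, act_mul, ht', ht]; group
  | inv t ht =>
    have := ht (act (comm t⁻¹) s)
    rw [← act_mul, map_inv, mul_inv_cancel, act_one] at this
    rw [map_inv]
    conv_rhs => rw [this]
    group

theorem inv_tmul (a k : G) : tmul a⁻¹ k = (act a⁻¹ (tmul a k))⁻¹ := by
  have := mul_tmul' a⁻¹ a k
  rw [inv_mul_cancel, one_tmul] at this
  exact (inv_eq_of_mul_eq_one_right this.symm).symm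

theorem comm_tmul_left (t : TensorSquare G) (k : G) : tmul (comm t) k = t * (act k t)⁻¹ := by
  induction t using induction with
  | tmul a b =>
    have h1 : tmul a b * act b (tmul a (b⁻¹ * k * b)) = tmul a k * act k (tmul a b) := by
      rw [← tmul_mul', ← tmul_mul']; congr 1; group
    have h2 : act (a * b * a⁻¹) (tmul a (b⁻¹ * k * b)) =
        tmul a b * act b (tmul a (b⁻¹ * k * b)) * (tmul a b)⁻¹ := by
      rw [← act_comm, ← act_mul, comm_tmul, inv_mul_cancel_right]
    have h3 : tmul (b * a⁻¹ * b⁻¹) k = act b (tmul a⁻¹ (b⁻¹ * k * b)) := by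
      rw [act_tmul]; congr 1; group
    have h4 : a * b * a⁻¹ * b⁻¹ = a * (b * a⁻¹ * b⁻¹) := by group
    rw [comm_tmul, h4, mul_tmul', h3, inv_tmul, map_inv, map_inv, ← act_mul, ← act_mul, h2, h1]
    group
  | one => simp
  | mul s t hs ht => rw [map_mul, mul_tmul', ht, hs, act_comm, map_mul]; group
  | inv t ht =>
    rw [map_inv, inv_tmul, ht, ← map_inv (comm : TensorSquare G →* G), act_comm, map_inv]; group

/-- The automorphism of `G ⊗ G` sending `a ⊗ b` to `(b ⊗ a)⁻¹`. -/
def swap : TensorSquare G →* TensorSquare G :=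
  lift (fun a b => (tmul b a)⁻¹)
    (fun g h k => by rw [tmul_mul, mul_inv_rev]) (fun g h k => by rw [mul_tmul, mul_inv_rev])

@[simp]
theorem swap_tmul (a b : G) : swap (tmul a b) = (tmul b a)⁻¹ :=
  lift_tmul _ _ _ _ _

theorem swap_swap (t : TensorSquare G) : swap (swap t) = t := by
  have : swap.comp swap = MonoidHom.id (TensorSquare G) := hom_ext fun a b => by simp
  exact DFunLike.congr_fun this t

theorem comm_swap (t : TensorSquare G) : comm (swap t) = comm t := by
  have : comm.comp swap = (comm : TensorSquare G →* G) :=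
    hom_ext fun a b => by simp [mul_assoc]
  exact DFunLike.congr_fun this t

theorem swap_act (g : G) (t : TensorSquare G) : swap (act g t) = act g (swap t) := by
  have : swap.comp (act g) = (act g).comp swap := hom_ext fun a b => by simp
  exact DFunLike.congr_fun this t

theorem tmul_comm_right (t : TensorSquare G) (k : G) : tmul k (comm t) = act k t * t⁻¹ := by
  have := congrArg swap (comm_tmul_left (swap t) k)
  rw [comm_swap, swap_tmul, map_mul, map_inv, swap_act, swap_swap] at this
  rw [← inv_inj, this]; group

theorem tmul_conj_mul_tmul (g h k : G) :
    tmul g (h * k * h⁻¹) * tmul h k = tmul (g * h) k := by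
  have : h * k * h⁻¹ = comm (tmul h k) * k := by simp
  rw [this, tmul_mul', tmul_comm_right, act_comm, mul_tmul']; group

theorem comm_mul_comm_inv (s t : TensorSquare G) :
    s * t * s⁻¹ * t⁻¹ = tmul (comm s) (comm t) := by
  rw [tmul_comm_right, act_comm]

theorem mem_center_of_comm {t : TensorSquare G} (ht : comm t = 1) :
    t ∈ Subgroup.center (TensorSquare G) := by
  rw [Subgroup.mem_center_iff]
  intro s
  have := act_comm t s
  rw [ht, act_one] at this
  exact mul_inv_eq_iff_eq_mul.1 this.symm |>.symm

theorem act_of_comm {t : TensorSquare G} (ht : comm t = 1) (g : G) : act g t = t := by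
  have := tmul_comm_right t g
  rw [ht, tmul_one] at this
  exact (mul_inv_eq_one.1 this.symm)

theorem comm_tmul_self (g : G) : comm (tmul g g) = 1 := by simp

theorem comm_tmul_mul_tmul (g h : G) : comm (tmul g h * tmul h g) = 1 := by
  simp [mul_assoc]

theorem commute_of_comm {t : TensorSquare G} (ht : comm t = 1) (s : TensorSquare G) :
    s * t = t * s :=
  Subgroup.mem_center_iff.1 (mem_center_of_comm ht) s

/-- The subgroup of `G ⊗ G` generated by the elements `g ⊗ g`. -/
def diag (G : Type u) [Group G] : Subgroup (TensorSquare G) :=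
  Subgroup.closure (Set.range fun g : G => tmul g g)

theorem tmul_self_mem_diag (g : G) : tmul g g ∈ diag G :=
  Subgroup.subset_closure ⟨g, rfl⟩

theorem diag_le_ker : diag G ≤ (comm : TensorSquare G →* G).ker := by
  rw [diag, Subgroup.closure_le]
  rintro _ ⟨g, rfl⟩
  exact comm_tmul_self g

instance : (diag G).Normal where
  conj_mem t ht s := by
    rw [commute_of_comm (diag_le_ker ht), mul_inv_cancel_right]; exact ht

theorem act_mem_diag {t : TensorSquare G} (ht : t ∈ diag G) (g : G) : act g t ∈ diag G := by
  rwa [act_of_comm (diag_le_ker ht)]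

theorem tmul_mul_tmul_swap (g h : G) : tmul g h * tmul h g = tmul h g * tmul g h := by
  have := commute_of_comm (comm_tmul_mul_tmul g h) (tmul g h)
  rw [mul_assoc] at this
  exact mul_left_cancel this

theorem tmul_mul_self (g h : G) :
    tmul (g * h) (g * h) = tmul g g * tmul h h * (tmul g h * tmul h g) := by
  have h1 : act (g * g) (tmul h h) = tmul h h := act_of_comm (comm_tmul_self h) _
  have h2 := act_of_comm (comm_tmul_mul_tmul g h) g
  rw [mul_tmul', tmul_mul' h g h, tmul_mul' g g h, map_mul, ← act_mul, h1,
    commute_of_comm (comm_tmul_self h), mul_assoc, ← mul_assoc _ (tmul g g),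
    commute_of_comm (comm_tmul_self g), mul_assoc (tmul g g), ← map_mul,
    ← tmul_mul_tmul_swap, h2, ← mul_assoc,
    ← commute_of_comm (comm_tmul_self h)]

theorem tmul_mul_tmul_mem_diag (g h : G) : tmul g h * tmul h g ∈ diag G := by
  have h1 := (diag G).mul_mem
    ((diag G).inv_mem ((diag G).mul_mem (tmul_self_mem_diag g) (tmul_self_mem_diag h)))
    (tmul_self_mem_diag (g * h))
  rwa [tmul_mul_self, inv_mul_cancel_left] at h1

theorem tmul_mem_diag_of_mem_zpowers {x y k : G} (hk : tmul x k ∈ diag G)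
    (hy : y ∈ Subgroup.zpowers x) : tmul y k ∈ diag G := by
  rw [Subgroup.zpowers_eq_closure] at hy
  induction hy using Subgroup.closure_induction with
  | mem y hy => rw [Set.mem_singleton_iff.1 hy]; exact hk
  | one => rw [one_tmul]; exact (diag G).one_mem
  | mul y z _ _ hy hz => rw [mul_tmul']; exact (diag G).mul_mem (act_mem_diag hz y) hy
  | inv y _ hy => rw [inv_tmul]; exact (diag G).inv_mem (act_mem_diag hy _)

theorem tmul_swap_mem_diag {g h : G} (H : tmul g h ∈ diag G) : tmul h g ∈ diag G :=
  ((diag G).mul_mem_cancel_left H).1 (tmul_mul_tmul_mem_diag g h)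

theorem zpow_tmul_zpow_mem_diag (x : G) (m n : ℤ) : tmul (x ^ m) (x ^ n) ∈ diag G :=
  tmul_mem_diag_of_mem_zpowers
    (tmul_swap_mem_diag (tmul_mem_diag_of_mem_zpowers (tmul_self_mem_diag x) ⟨n, rfl⟩)) ⟨m, rfl⟩

open scoped IsMulCommutative commutatorElement

/-- The element `g ⊗ g` of the center of `G ⊗ G`. -/
def sq (g : G) : Subgroup.center (TensorSquare G) :=
  ⟨tmul g g, mem_center_of_comm (comm_tmul_self g)⟩

/-- The element `(g ⊗ h)(h ⊗ g)` of the center of `G ⊗ G`. -/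
def sqPolar (g h : G) : Subgroup.center (TensorSquare G) :=
  ⟨tmul g h * tmul h g, mem_center_of_comm (comm_tmul_mul_tmul g h)⟩

theorem sq_mul (g h : G) : sq (g * h) = sq g * sq h * sqPolar g h :=
  Subtype.ext (tmul_mul_self g h)

theorem sqPolar_comm (g h : G) : sqPolar g h = sqPolar h g :=
  Subtype.ext (tmul_mul_tmul_swap g h)

theorem sqPolar_mul_left (g h k : G) : sqPolar (g * h) k = sqPolar g k * sqPolar h k := by
  refine Subtype.ext ?_
  have h1 := act_of_comm (comm_tmul_mul_tmul h k) g
  have h2 := commute_of_comm (comm_tmul_mul_tmul g k)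
  change tmul (g * h) k * tmul k (g * h) =
    tmul g k * tmul k g * (tmul h k * tmul k h)
  rw [mul_tmul', tmul_mul' k g h, mul_assoc, ← mul_assoc (tmul g k), ← mul_assoc, h2, mul_assoc,
    ← map_mul, h1]

/-- `sqPolar` as a homomorphism in its first argument. -/
def sqPolarHom (k : G) : G →* Subgroup.center (TensorSquare G) :=
  MonoidHom.mk' (fun g => sqPolar g k) fun g h => sqPolar_mul_left g h k

theorem sqPolar_of_mem_commutator {c : G} (hc : c ∈ commutator G) (k : G) : sqPolar c k = 1 :=
  Abelianization.commutator_subset_ker (sqPolarHom k) hc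

theorem sq_comm (g h : G) : sq (g * h) = sq (h * g) := by
  rw [sq_mul, sq_mul, sqPolar_comm, mul_comm (sq g)]

theorem sq_one : sq (1 : G) = 1 := Subtype.ext (one_tmul 1)

theorem sqPolar_inv_left (g k : G) : sqPolar g⁻¹ k = (sqPolar g k)⁻¹ := (sqPolarHom k).map_inv g

theorem sqPolar_self (g : G) : sqPolar g g = sq g * sq g := rfl

theorem sq_inv (g : G) : sq g⁻¹ = sq g := by
  have := sq_mul g⁻¹ g
  rw [inv_mul_cancel, sq_one, sqPolar_inv_left, sqPolar_self] at this
  rw [← mul_inv_eq_one, this]; group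

theorem sq_of_mem_commutator {c : G} (hc : c ∈ commutator G) : sq c = 1 := by
  rw [commutator_eq_closure] at hc
  induction hc using Subgroup.closure_induction with
  | mem x hx =>
    obtain ⟨a, b, rfl⟩ := hx
    have h1 : sqPolar ⁅a, b⁆ (b * a) = 1 := sqPolar_of_mem_commutator
      (Subgroup.commutator_mem_commutator (Subgroup.mem_top a) (Subgroup.mem_top b)) _
    have h2 := sq_mul ⁅a, b⁆ (b * a)
    have h3 : ⁅a, b⁆ * (b * a) = a * b := by rw [commutatorElement_def]; group
    rw [h3, h1, mul_one, sq_comm] at h2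
    exact (right_eq_mul.1 h2)
  | one => exact sq_one
  | mul x y hx hy h1 h2 =>
    rw [← commutator_eq_closure] at hx
    rw [sq_mul, h1, h2, sqPolar_of_mem_commutator hx]; simp
  | inv x _ hx => rw [sq_inv, hx]

theorem sq_eq_of_abelianization {g h : G} (H : Abelianization.of g = Abelianization.of h) :
    sq g = sq h := by
  have hc : g⁻¹ * h ∈ commutator G := QuotientGroup.eq.1 H
  have := sq_mul g (g⁻¹ * h)
  rw [mul_inv_cancel_left, sqPolar_comm, sqPolar_of_mem_commutator hc,
    sq_of_mem_commutator hc, mul_one, mul_one] at this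
  exact this.symm

/-- The map `g ↦ g ⊗ g` on the abelianization. -/
noncomputable def sqAb (x : Additive (Abelianization G)) :
    Additive (Subgroup.center (TensorSquare G)) :=
  Additive.ofMul (sq (Quotient.out (Additive.toMul x : G ⧸ commutator G)))

theorem sqAb_of (g : G) : sqAb (Additive.ofMul (Abelianization.of g)) = Additive.ofMul (sq g) :=
  congrArg Additive.ofMul (sq_eq_of_abelianization (Quotient.out_eq _))

theorem polar_sqAb_of (g h : G) :
    QuadraticMap.polar sqAb (Additive.ofMul (Abelianization.of g))
      (Additive.ofMul (Abelianization.of h)) = Additive.ofMul (sqPolar g h) := by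
  rw [QuadraticMap.polar, ← ofMul_mul, ← map_mul, sqAb_of, sqAb_of, sqAb_of, sq_mul,
    ofMul_mul, ofMul_mul]
  abel

theorem polar_sqAb_add (x x' y : Additive (Abelianization G)) :
    QuadraticMap.polar sqAb (x + x') y =
      QuadraticMap.polar sqAb x y + QuadraticMap.polar sqAb x' y := by
  obtain ⟨g, rfl⟩ : ∃ g : G, Additive.ofMul (Abelianization.of g) = x :=
    QuotientGroup.mk_surjective (s := commutator G) x
  obtain ⟨g', rfl⟩ : ∃ g : G, Additive.ofMul (Abelianization.of g) = x' :=
    QuotientGroup.mk_surjective (s := commutator G) x'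
  obtain ⟨h, rfl⟩ : ∃ g : G, Additive.ofMul (Abelianization.of g) = y :=
    QuotientGroup.mk_surjective (s := commutator G) y
  rw [← ofMul_mul, ← map_mul, polar_sqAb_of, polar_sqAb_of, polar_sqAb_of, sqPolar_mul_left,
    ofMul_mul]

theorem polar_sqAb_zsmul (a : ℤ) (x y : Additive (Abelianization G)) :
    QuadraticMap.polar sqAb (a • x) y = a • QuadraticMap.polar sqAb x y :=
  (AddMonoidHom.mk' (fun x => QuadraticMap.polar sqAb x y)
    fun x x' => polar_sqAb_add x x' y).map_zsmul a x

theorem sqAb_add (x y : Additive (Abelianization G)) :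
    sqAb (x + y) = sqAb x + sqAb y + QuadraticMap.polar sqAb x y := by
  rw [QuadraticMap.polar]; abel

theorem polar_sqAb_self (x : Additive (Abelianization G)) :
    QuadraticMap.polar sqAb x x = (2 : ℤ) • sqAb x := by
  obtain ⟨g, rfl⟩ : ∃ g : G, Additive.ofMul (Abelianization.of g) = x :=
    QuotientGroup.mk_surjective (s := commutator G) x
  rw [polar_sqAb_of, sqPolar_self, ofMul_mul, sqAb_of, two_zsmul]

theorem sqAb_zsmul (a : ℤ) (x : Additive (Abelianization G)) :
    sqAb (a • x) = (a * a) • sqAb x := by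
  induction a using Int.induction_on with
  | zero =>
    have h := sqAb_add (0 : Additive (Abelianization G)) 0
    have h0 := polar_sqAb_zsmul 0 x x
    have h1 := polar_sqAb_zsmul 0 (0 : Additive (Abelianization G)) 0
    rw [zero_zsmul, zero_zsmul] at h1
    rw [h1, add_zero, add_zero, left_eq_add] at h
    simpa using h
  | succ n ih =>
    rw [add_zsmul, sqAb_add, one_zsmul, ih, polar_sqAb_zsmul, polar_sqAb_self]
    module
  | pred n ih =>
    have h := sqAb_add ((-(n : ℤ) - 1) • x) x
    have e : (-(n : ℤ) - 1) • x + x = (-(n : ℤ)) • x := by module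
    rw [e, ih, polar_sqAb_zsmul, polar_sqAb_self] at h
    rw [add_assoc, ← sub_eq_iff_eq_add] at h
    rw [← h]
    module

/-- The quadratic map on the abelianization given by `g ↦ g ⊗ g`. -/
noncomputable def sqQuadratic (G : Type u) [Group G] :
    QuadraticMap ℤ (Additive (Abelianization G)) (Additive (Subgroup.center (TensorSquare G))) :=
  QuadraticMap.ofPolar sqAb sqAb_zsmul polar_sqAb_add polar_sqAb_zsmul

/-- The homomorphism to an abelian group induced by a bilinear map on the abelianization. -/
def liftAb {A : Type*} [AddCommGroup A]
    (b : Additive (Abelianization G) →ₗ[ℤ] Additive (Abelianization G) →ₗ[ℤ] A) :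
    TensorSquare G →* Multiplicative A :=
  lift (fun g h => Multiplicative.ofAdd (b (Additive.ofMul (Abelianization.of g))
      (Additive.ofMul (Abelianization.of h))))
    (fun g h k => by
      simp only [map_mul, map_inv, ofMul_mul, ofMul_inv, ← ofAdd_add]
      congr 1
      simp only [map_add, map_neg, LinearMap.add_apply, LinearMap.neg_apply]
      abel)
    (fun g h k => by
      simp only [map_mul, map_inv, ofMul_mul, ofMul_inv, ← ofAdd_add]
      congr 1
      simp only [map_add, map_neg, LinearMap.add_apply, LinearMap.neg_apply]
      abel)

open scoped TensorProduct in
theorem eq_one_of_mem_diag [Module.Free ℤ (Additive (Abelianization G))] {t : TensorSquare G}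
    (ht : t ∈ diag G) (hfin : IsOfFinOrder t) : t = 1 := by
  obtain ⟨b, hb⟩ := LinearMap.BilinMap.toQuadraticMap_surjective (sqQuadratic G)
  let π : TensorSquare G →*
      Multiplicative (Additive (Abelianization G) ⊗[ℤ] Additive (Abelianization G)) :=
    liftAb (TensorProduct.mk ℤ _ _)
  let ρ : TensorSquare G →* TensorSquare G :=
    (Subgroup.center (TensorSquare G)).subtype.comp
      ((AddMonoidHom.toMultiplicativeLeft (TensorProduct.lift b).toAddMonoidHom).comp π)
  have hπ : π t = 1 := by
    obtain ⟨n, hn, h⟩ := isOfFinOrder_iff_pow_eq_one.1 (π.isOfFinOrder hfin)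
    have : Module.Free ℤ (Additive (Abelianization G) ⊗[ℤ] Additive (Abelianization G)) :=
      Module.Free.tensor
    have h' : (n : ℤ) • Multiplicative.toAdd (π t) = 0 := by rw [natCast_zsmul]; exact h
    exact (smul_eq_zero.1 h').resolve_left (by exact_mod_cast hn.ne')
  have hρ : diag G ≤ ρ.eqLocus (MonoidHom.id _) := by
    rw [diag, Subgroup.closure_le]
    rintro _ ⟨g, rfl⟩
    have := DFunLike.congr_fun hb (Additive.ofMul (Abelianization.of g))
    rw [LinearMap.BilinMap.toQuadraticMap_apply] at this
    have h2 : sqQuadratic G (Additive.ofMul (Abelianization.of g)) = Additive.ofMul (sq g) :=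
      sqAb_of g
    rw [h2] at this
    change ρ (tmul g g) = tmul g g
    have h3 : ρ (tmul g g) = ((Additive.toMul (b (Additive.ofMul (Abelianization.of g))
      (Additive.ofMul (Abelianization.of g))) : Subgroup.center (TensorSquare G)) :
        TensorSquare G) := by
      simp only [ρ, π, liftAb, MonoidHom.comp_apply, lift_tmul]
      rfl
    rw [h3, this]
    rfl
  have h1 : ρ t = t := hρ ht
  rw [← h1]
  simp [ρ, hπ]

end TensorSquare

/-- A group over `G` receiving a homomorphism from `G ⊗ G` which computes commutators and whose
kernel is the diagonal subgroup. -/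
structure CommutatorModel (G : Type u) [Group G] where
  /-- The total group. -/
  carrier : Type u
  [group : Group carrier]
  /-- The projection to `G`. -/
  proj : carrier →* G
  /-- The homomorphism from the tensor square. -/
  incl : TensorSquare G →* carrier
  proj_incl : ∀ t, proj (incl t) = TensorSquare.comm t
  commutator_eq : ∀ u v : carrier, u * v * u⁻¹ * v⁻¹ = incl (tmul (proj u) (proj v))
  incl_eq_one : ∀ t, incl t = 1 ↔ t ∈ TensorSquare.diag G

namespace CommutatorModel

open TensorSquare
open scoped commutatorElement

variable {G : Type u} [Group G]

attribute [instance] CommutatorModel.group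

/-- The model given by the quotient of `G ⊗ G` by the diagonal subgroup. -/
def base (G : Type u) [Group G] : CommutatorModel G where
  carrier := TensorSquare G ⧸ diag G
  proj := QuotientGroup.lift (diag G) TensorSquare.comm diag_le_ker
  incl := QuotientGroup.mk' (diag G)
  proj_incl _ := rfl
  commutator_eq u v := by
    obtain ⟨s, rfl⟩ := QuotientGroup.mk'_surjective (diag G) u
    obtain ⟨t, rfl⟩ := QuotientGroup.mk'_surjective (diag G) v
    rw [← map_inv, ← map_inv, ← map_mul, ← map_mul, ← map_mul, comm_mul_comm_inv]
    rfl
  incl_eq_one t := QuotientGroup.eq_one_iff t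

variable (M : CommutatorModel G)

theorem conj_incl (u : M.carrier) (t : TensorSquare G) :
    u * M.incl t * u⁻¹ = M.incl (act (M.proj u) t) := by
  have := M.commutator_eq u (M.incl t)
  rw [M.proj_incl, tmul_comm_right, map_mul, map_inv, mul_left_inj] at this
  exact this

theorem incl_tmul_swap (g h : G) : M.incl (tmul h g) = (M.incl (tmul g h))⁻¹ := by
  rw [eq_inv_iff_mul_eq_one, ← map_mul, M.incl_eq_one]
  exact tmul_mul_tmul_mem_diag h g

/-- The endomorphism `u ↦ (g ⊗ proj u) u` of a model. -/
def twist (g : G) : M.carrier →* M.carrier :=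
  MonoidHom.mk' (fun u => M.incl (tmul g (M.proj u)) * u) fun u v => by
    rw [map_mul, tmul_mul', map_mul, ← conj_incl]; group

theorem twist_apply (g : G) (u : M.carrier) :
    M.twist g u = M.incl (tmul g (M.proj u)) * u := rfl

theorem proj_twist (g : G) (u : M.carrier) : M.proj (M.twist g u) = g * M.proj u * g⁻¹ := by
  rw [twist_apply, map_mul, M.proj_incl, comm_tmul]; group

theorem twist_mul (g h : G) (u : M.carrier) : M.twist (g * h) u = M.twist g (M.twist h u) := by
  rw [twist_apply M g, proj_twist, twist_apply, twist_apply, ← mul_assoc, ← map_mul,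
    tmul_conj_mul_tmul]

theorem twist_one (u : M.carrier) : M.twist 1 u = u := by
  rw [twist_apply, one_tmul, map_one, one_mul]

theorem twist_incl (g : G) (t : TensorSquare G) : M.twist g (M.incl t) = M.incl (act g t) := by
  rw [twist_apply, M.proj_incl, tmul_comm_right, map_mul, map_inv, inv_mul_cancel_right]

/-- The action of `G` on a model by `u ↦ (g ⊗ proj u) u`. -/
def aut : G →* MulAut M.carrier where
  toFun g := MonoidHom.toMulEquiv (M.twist g) (M.twist g⁻¹)
    (MonoidHom.ext fun u => by
      rw [MonoidHom.comp_apply, ← twist_mul, inv_mul_cancel, twist_one, MonoidHom.id_apply])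
    (MonoidHom.ext fun u => by
      rw [MonoidHom.comp_apply, ← twist_mul, mul_inv_cancel, twist_one, MonoidHom.id_apply])
  map_one' := MulEquiv.ext M.twist_one
  map_mul' g h := MulEquiv.ext (M.twist_mul g h)

theorem aut_apply (g : G) (u : M.carrier) : M.aut g u = M.twist g u := rfl

/-- The underlying group of the model obtained by adjoining a lift of `x`. -/
abbrev Adjoin (x : G) : Type u :=
  M.carrier ⋊[M.aut.comp (zpowersHom G x)] Multiplicative ℤ

/-- The projection of the model obtained by adjoining a lift of `x`. -/
def adjoinProj (x : G) : M.Adjoin x →* G :=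
  SemidirectProduct.lift M.proj (zpowersHom G x) fun k => MonoidHom.ext fun u =>
    M.proj_twist (zpowersHom G x k) u

/-- The homomorphism from the tensor square to the model obtained by adjoining a lift of `x`. -/
def adjoinIncl (x : G) : TensorSquare G →* M.Adjoin x :=
  SemidirectProduct.inl.comp M.incl

theorem adjoinProj_inl (x : G) (u : M.carrier) :
    M.adjoinProj x (SemidirectProduct.inl u) = M.proj u :=
  SemidirectProduct.lift_inl _ _ _ _

theorem adjoinProj_inr (x : G) (k : Multiplicative ℤ) :
    M.adjoinProj x (SemidirectProduct.inr k) = zpowersHom G x k :=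
  SemidirectProduct.lift_inr _ _ _ _

theorem conj_adjoinIncl (x : G) (u : M.Adjoin x) (t : TensorSquare G) :
    u * M.adjoinIncl x t * u⁻¹ = M.adjoinIncl x (act (M.adjoinProj x u) t) := by
  have hl (v : M.carrier) (t : TensorSquare G) :
      (SemidirectProduct.inl v : M.Adjoin x) * M.adjoinIncl x t * (SemidirectProduct.inl v)⁻¹ =
        M.adjoinIncl x (act (M.proj v) t) := by
    simp only [adjoinIncl, MonoidHom.comp_apply]
    rw [← map_inv, ← map_mul, ← map_mul, conj_incl]
  have hr (k : Multiplicative ℤ) (t : TensorSquare G) :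
      (SemidirectProduct.inr k : M.Adjoin x) * M.adjoinIncl x t * (SemidirectProduct.inr k)⁻¹ =
        M.adjoinIncl x (act (zpowersHom G x k) t) := by
    simp only [adjoinIncl, MonoidHom.comp_apply]
    rw [← map_inv, ← SemidirectProduct.inl_aut, MonoidHom.comp_apply, aut_apply, twist_incl]
  rw [← SemidirectProduct.inl_left_mul_inr_right u, map_mul, adjoinProj_inl, adjoinProj_inr,
    act_mul, ← hl, ← hr]
  group

theorem adjoin_commutator_eq (x : G) (u v : M.Adjoin x) :
    u * v * u⁻¹ * v⁻¹ = M.adjoinIncl x (tmul (M.adjoinProj x u) (M.adjoinProj x v)) := by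
  let p (u v : M.Adjoin x) : Prop :=
    u * v * u⁻¹ * v⁻¹ = M.adjoinIncl x (tmul (M.adjoinProj x u) (M.adjoinProj x v))
  have mul {u u' v : M.Adjoin x} (h : p u v) (h' : p u' v) : p (u * u') v := by
    have e : u * u' * v * (u * u')⁻¹ * v⁻¹ =
        u * (u' * v * u'⁻¹ * v⁻¹) * u⁻¹ * (u * v * u⁻¹ * v⁻¹) := by group
    change _ = _
    rw [e, h, h', conj_adjoinIncl, ← map_mul, map_mul (M.adjoinProj x), mul_tmul']
  have swap {u v : M.Adjoin x} (h : p u v) : p v u := by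
    have e : v * u * v⁻¹ * u⁻¹ = (u * v * u⁻¹ * v⁻¹)⁻¹ := by group
    change _ = _
    rw [e, h, adjoinIncl, MonoidHom.comp_apply, MonoidHom.comp_apply, M.incl_tmul_swap, map_inv,
      inv_inv]
  have ll (a b : M.carrier) : p (SemidirectProduct.inl a) (SemidirectProduct.inl b) := by
    change _ = _
    rw [← map_inv, ← map_inv, ← map_mul, ← map_mul, ← map_mul, M.commutator_eq,
      adjoinProj_inl, adjoinProj_inl]
    rfl
  have rl (k : Multiplicative ℤ) (b : M.carrier) :
      p (SemidirectProduct.inr k) (SemidirectProduct.inl b) := by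
    change _ = _
    rw [← map_inv SemidirectProduct.inr, ← SemidirectProduct.inl_aut, MonoidHom.comp_apply,
      aut_apply, twist_apply, ← map_inv, ← map_mul, mul_inv_cancel_right, adjoinProj_inl,
      adjoinProj_inr]
    rfl
  have rr (k l : Multiplicative ℤ) :
      p (SemidirectProduct.inr k) (SemidirectProduct.inr l) := by
    change _ = _
    rw [← map_inv, ← map_inv, ← map_mul, ← map_mul, ← map_mul, mul_inv_cancel_comm,
      mul_inv_cancel, map_one, adjoinProj_inr, adjoinProj_inr, adjoinIncl, MonoidHom.comp_apply,
      zpowersHom_apply, zpowersHom_apply, (M.incl_eq_one _).2 (zpow_tmul_zpow_mem_diag x _ _),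
      map_one]
  have hl (u : M.Adjoin x) (b : M.carrier) : p u (SemidirectProduct.inl b) := by
    rw [← SemidirectProduct.inl_left_mul_inr_right u]
    exact mul (ll _ _) (rl _ _)
  have hr (u : M.Adjoin x) (l : Multiplicative ℤ) : p u (SemidirectProduct.inr l) := by
    rw [← SemidirectProduct.inl_left_mul_inr_right u]
    exact mul (swap (rl _ _)) (rr _ _)
  have h : p v u := by
    rw [← SemidirectProduct.inl_left_mul_inr_right v]
    exact mul (swap (hl _ _)) (swap (hr _ _))
  exact swap h

/-- The model obtained by adjoining a lift of `x`. -/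
def adjoin (x : G) : CommutatorModel G where
  carrier := M.Adjoin x
  proj := M.adjoinProj x
  incl := M.adjoinIncl x
  proj_incl t := (M.adjoinProj_inl x _).trans (M.proj_incl t)
  commutator_eq := M.adjoin_commutator_eq x
  incl_eq_one t := by
    rw [← M.incl_eq_one]
    exact map_eq_one_iff _ SemidirectProduct.inl_injective

theorem range_le_range_adjoin (x : G) : M.proj.range ≤ (M.adjoin x).proj.range := by
  rintro _ ⟨u, rfl⟩
  exact ⟨(SemidirectProduct.inl u : M.Adjoin x), M.adjoinProj_inl x u⟩

theorem mem_range_adjoin (x : G) : x ∈ (M.adjoin x).proj.range :=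
  ⟨(SemidirectProduct.inr (Multiplicative.ofAdd 1) : M.Adjoin x),
    (M.adjoinProj_inr x _).trans (by simp)⟩

theorem exists_subset_range (s : Finset G) :
    ∃ M : CommutatorModel G, (s : Set G) ⊆ M.proj.range := by
  classical
  induction s using Finset.induction_on with
  | empty => exact ⟨base G, by simp⟩
  | insert x s _ ih =>
    obtain ⟨M, hM⟩ := ih
    refine ⟨M.adjoin x, ?_⟩
    rw [Finset.coe_insert, Set.insert_subset_iff]
    exact ⟨M.mem_range_adjoin x, hM.trans (M.range_le_range_adjoin x)⟩

theorem commutator_le_range : commutator G ≤ M.proj.range := by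
  rw [commutator_eq_closure, Subgroup.closure_le]
  rintro _ ⟨a, b, rfl⟩
  exact ⟨M.incl (tmul a b), by rw [M.proj_incl, comm_tmul, commutatorElement_def]⟩

theorem exists_surjective (h : Group.FG (Abelianization G)) :
    ∃ M : CommutatorModel G, Function.Surjective M.proj := by
  classical
  obtain ⟨s, hs⟩ := Group.fg_def.1 h
  have hout (x : Abelianization G) : Abelianization.of (Quotient.out (x : G ⧸ commutator G)) = x :=
    Quotient.out_eq x
  obtain ⟨M, hM⟩ := exists_subset_range
    (s.image fun x : Abelianization G => Quotient.out (x : G ⧸ commutator G))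
  refine ⟨M, MonoidHom.range_eq_top.1 (top_le_iff.1 fun g _ => ?_)⟩
  have h1 : (⊤ : Subgroup (Abelianization G)) ≤ M.proj.range.map Abelianization.of := by
    rw [← hs, Subgroup.closure_le]
    intro x hx
    exact ⟨_, hM (Finset.mem_coe.2 (Finset.mem_image_of_mem _ hx)), hout x⟩
  obtain ⟨g', hg', e⟩ := h1 (Subgroup.mem_top (Abelianization.of g))
  have h2 : g'⁻¹ * g ∈ commutator G := QuotientGroup.eq.1 e
  have := M.proj.range.mul_mem hg' (M.commutator_le_range h2)
  rwa [mul_inv_cancel_left] at this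

end CommutatorModel

namespace TensorSquare

open scoped commutatorElement

variable {G : Type u} [Group G]

/-- A central extension of `G` receives a homomorphism from `G ⊗ G` computing commutators. -/
theorem exists_hom_of_central {E : Type*} [Group E] (p : E →* G) (hp : Function.Surjective p)
    (hc : ∀ e, p e = 1 → e ∈ Subgroup.center E) :
    ∃ f : TensorSquare G →* E, ∀ u v, f (tmul (p u) (p v)) = u * v * u⁻¹ * v⁻¹ := by
  have key (u u' v v' : E) (h : p u = p u') (h' : p v = p v') :
      u * v * u⁻¹ * v⁻¹ = u' * v' * u'⁻¹ * v'⁻¹ := by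
    have h1 := Subgroup.mem_center_iff.1 (hc (u⁻¹ * u') (by simp [h]))
    have h2 := Subgroup.mem_center_iff.1 (hc (v⁻¹ * v') (by simp [h']))
    obtain ⟨y, hy⟩ : ∃ y, y = u⁻¹ * u' := ⟨_, rfl⟩
    obtain ⟨z, hz⟩ : ∃ z, z = v⁻¹ * v' := ⟨_, rfl⟩
    rw [← hy] at h1
    rw [← hz] at h2
    obtain rfl : u' = u * y := by rw [hy]; group
    obtain rfl : v' = v * z := by rw [hz]; group
    have e1 : u * y * (v * z) * (u * y)⁻¹ * (v * z)⁻¹ =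
        u * (y * v) * (z * y⁻¹) * u⁻¹ * z⁻¹ * v⁻¹ := by group
    rw [e1, ← h1, ← h2 y⁻¹]
    have e2 : u * (v * y) * (y⁻¹ * z) * u⁻¹ * z⁻¹ * v⁻¹ = u * v * (z * u⁻¹) * z⁻¹ * v⁻¹ := by group
    rw [e2, ← h2]
    group
  choose s hs using hp
  refine ⟨lift (fun g h => s g * s h * (s g)⁻¹ * (s h)⁻¹) (fun g h k => ?_) (fun g h k => ?_),
    fun u v => ?_⟩
  · rw [key (s (g * h)) (s g * s h) (s k) (s k) (by simp [hs]) rfl,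
      key (s (g * h * g⁻¹)) (s g * s h * (s g)⁻¹) (s (g * k * g⁻¹)) (s g * s k * (s g)⁻¹)
        (by simp [hs]) (by simp [hs])]
    group
  · rw [key (s g) (s g) (s (h * k)) (s h * s k) rfl (by simp [hs]),
      key (s (h * g * h⁻¹)) (s h * s g * (s h)⁻¹) (s (h * k * h⁻¹)) (s h * s k * (s h)⁻¹)
        (by simp [hs]) (by simp [hs])]
    group
  · rw [lift_tmul]
    exact key _ _ _ _ (hs _) (hs _)

/-- Miller's theorem, in the form: torsion in the kernel of the commutator map lies in the diagonal
subgroup when `H₂(G)` is torsion-free. -/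
theorem mem_diag_of_isOfFinOrder (hfg : Group.FG (Abelianization G))
    (hH2 : ∀ a : H2 G, IsOfFinOrder a → a = 1) {t : TensorSquare G} (ht : comm t = 1)
    (hfin : IsOfFinOrder t) : t ∈ diag G := by
  obtain ⟨M, hM⟩ := CommutatorModel.exists_surjective hfg
  let π : FreeGroup G →* G := FreeGroup.lift id
  let K : Subgroup (FreeGroup G) := ⁅(⊤ : Subgroup (FreeGroup G)), presKernel G⁆
  have hKR : K ≤ presKernel G := Subgroup.commutator_le_right _ _
  let q : FreeGroup G →* FreeGroup G ⧸ K := QuotientGroup.mk' K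
  let p : FreeGroup G ⧸ K →* G := QuotientGroup.lift K π hKR
  have hpq (w : FreeGroup G) : p (q w) = π w := rfl
  have hp : Function.Surjective p := fun g => ⟨q (FreeGroup.of g), by rw [hpq]; simp [π]⟩
  have hc (e) (he : p e = 1) : e ∈ Subgroup.center (FreeGroup G ⧸ K) := by
    obtain ⟨w, rfl⟩ := QuotientGroup.mk'_surjective K e
    rw [Subgroup.mem_center_iff]
    intro e'
    obtain ⟨w', rfl⟩ := QuotientGroup.mk'_surjective K e'
    have h1 : ⁅w', w⁆ ∈ K := Subgroup.commutator_mem_commutator (Subgroup.mem_top _) he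
    have h2 := (QuotientGroup.eq_one_iff _).2 h1
    change QuotientGroup.mk' K ⁅w', w⁆ = 1 at h2
    rwa [map_commutatorElement, commutatorElement_eq_one_iff_mul_comm] at h2
  obtain ⟨f, hf⟩ := exists_hom_of_central p hp hc
  choose s hs using hM
  let σ : FreeGroup G →* M.carrier := FreeGroup.lift s
  have hσ (w : FreeGroup G) : M.proj (σ w) = π w := by
    have : M.proj.comp σ = π := FreeGroup.ext_hom _ _ fun g => by simp [σ, π, hs]
    exact DFunLike.congr_fun this w
  have hσK : K ≤ σ.ker := by
    rw [Subgroup.commutator_le]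
    intro w _ r hr
    have hr' : π r = 1 := hr
    rw [MonoidHom.mem_ker, map_commutatorElement, commutatorElement_def, M.commutator_eq, hσ, hσ,
      hr', tmul_one, map_one]
  let τ : FreeGroup G ⧸ K →* M.carrier := QuotientGroup.lift K σ hσK
  have hτ : τ.comp f = M.incl := hom_ext fun a b => by
    have := hf (q (FreeGroup.of a)) (q (FreeGroup.of b))
    have hπ (a : G) : p (q (FreeGroup.of a)) = a := by rw [hpq]; simp [π]
    rw [hπ, hπ] at this
    have h2 (w) : τ (q w) = σ w := rfl
    rw [MonoidHom.comp_apply, this]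
    simp only [map_mul, map_inv, h2]
    rw [M.commutator_eq, hσ, hσ]
    simp [π]
  have hpf : p.comp f = comm := hom_ext fun a b => by
    obtain ⟨u, rfl⟩ := hp a
    obtain ⟨v, rfl⟩ := hp b
    rw [MonoidHom.comp_apply, hf, comm_tmul]; simp
  have hrange (t : TensorSquare G) : f t ∈ (commutator (FreeGroup G)).map q := by
    induction t using induction with
    | tmul a b =>
      obtain ⟨u, rfl⟩ := hp a
      obtain ⟨v, rfl⟩ := hp b
      obtain ⟨u, rfl⟩ := QuotientGroup.mk'_surjective K u
      obtain ⟨v, rfl⟩ := QuotientGroup.mk'_surjective K v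
      rw [hf]
      exact ⟨⁅u, v⁆, Subgroup.commutator_mem_commutator (Subgroup.mem_top _) (Subgroup.mem_top _),
        by simp [commutatorElement_def, q]⟩
    | one => rw [map_one]; exact Subgroup.one_mem _
    | mul s t hs ht => rw [map_mul]; exact Subgroup.mul_mem _ hs ht
    | inv t ht => rw [map_inv]; exact Subgroup.inv_mem _ ht
  obtain ⟨w, hw, hwt⟩ := hrange t
  have hwR : w ∈ presKernel G := by
    change π w = 1
    rw [← hpq, hwt, ← MonoidHom.comp_apply, hpf, ht]
  obtain ⟨n, hn, h⟩ := isOfFinOrder_iff_pow_eq_one.1 hfin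
  have hwn : w ^ n ∈ K := by
    refine (QuotientGroup.eq_one_iff _).1 ?_
    change q (w ^ n) = 1
    rw [map_pow, hwt, ← map_pow, h, map_one]
  let a : ↥(presKernel G ⊓ commutator (FreeGroup G)) := ⟨w, hwR, hw⟩
  let N : Subgroup ↥(presKernel G ⊓ commutator (FreeGroup G)) :=
    K.subgroupOf (presKernel G ⊓ commutator (FreeGroup G))
  have ha : IsOfFinOrder (QuotientGroup.mk' N a) := by
    refine isOfFinOrder_iff_pow_eq_one.2 ⟨n, hn, ?_⟩
    rw [← map_pow]
    exact (QuotientGroup.eq_one_iff _).2 (Subgroup.mem_subgroupOf.2 hwn)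
  have ha1 : QuotientGroup.mk' N a = 1 := hH2 _ ha
  have hwK : w ∈ K := Subgroup.mem_subgroupOf.1 ((QuotientGroup.eq_one_iff _).1 ha1)
  have hft : f t = 1 := by rw [← hwt]; exact (QuotientGroup.eq_one_iff _).2 hwK
  rw [← M.incl_eq_one, ← hτ, MonoidHom.comp_apply, hft, map_one]

end TensorSquare

theorem isLeftOrderable_of_isMulTorsionFree (A : Type u) [CommGroup A] [IsMulTorsionFree A] :
    IsLeftOrderable A := by
  let V := DivisibleHull (Additive A)
  let b := Module.Basis.ofVectorSpace ℚ V
  let : LinearOrder (Module.Basis.ofVectorSpaceIndex ℚ V) :=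
    IsWellOrder.linearOrder WellOrderingRel
  let φ : A → Lex (Module.Basis.ofVectorSpaceIndex ℚ V →₀ ℚ) := fun a =>
    toLex (b.repr (DivisibleHull.coeAddMonoidHom (Additive A) (Additive.ofMul a)))
  have hmul (a a' : A) : φ (a * a') = φ a + φ a' := by
    simp only [φ, ofMul_mul, map_add, toLex_add]
  have hinj : Function.Injective φ := fun a a' h =>
    Additive.ofMul.injective (DivisibleHull.coe_injective (b.repr.injective (toLex.injective h)))
  refine ⟨fun a a' => φ a < φ a', ?_, fun h a a' H => ?_⟩
  · exact
      { trichotomous := fun a a' h h' => hinj (le_antisymm (not_lt.1 h') (not_lt.1 h))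
        irrefl := fun a => lt_irrefl _
        trans := fun _ _ _ => lt_trans }
  · change φ (h * a) < φ (h * a')
    rw [hmul, hmul]
    exact add_lt_add_right (show φ a < φ a' from H) _

theorem isLeftOrderable_of_ker {T : Type*} {E : Type*} [Group T] [Group E] (f : T →* E)
    (hE : IsLeftOrderable E) (hK : IsLeftOrderable f.ker) : IsLeftOrderable T := by
  obtain ⟨r, hr, hrm⟩ := hE
  obtain ⟨s, hs, hsm⟩ := hK
  refine ⟨fun a b => r (f a) (f b) ∨ ∃ k : f.ker, s 1 k ∧ b = a * k, ?_, ?_⟩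
  · refine { trichotomous := fun a b h h' => ?_, irrefl := ?_, trans := ?_ }
    · push Not at h h'
      have hab : f a = f b := hr.trichotomous _ _ h.1 h'.1
      let k : f.ker := ⟨a⁻¹ * b, by rw [MonoidHom.mem_ker]; simp [hab]⟩
      have h1 : ¬ s 1 k := fun hk => h.2 k hk (by simp [k])
      have h2 : ¬ s k 1 := fun hk => h'.2 k⁻¹ (by simpa using hsm k⁻¹ _ _ hk) (by simp [k])
      have h3 : (1 : T) = a⁻¹ * b := congrArg Subtype.val (hs.trichotomous _ _ h1 h2)
      exact inv_mul_eq_one.1 h3.symm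
    · rintro a (h | ⟨k, hk, h⟩)
      · exact hr.irrefl _ h
      · obtain rfl : k = 1 := Subtype.ext (left_eq_mul.1 h)
        exact hs.irrefl _ hk
    · rintro a b c (h | ⟨k, hk, rfl⟩) (h' | ⟨k', hk', rfl⟩)
      · exact Or.inl (hr.trans _ _ _ h h')
      · left; rwa [map_mul, k'.2, mul_one]
      · left; rwa [map_mul, k.2, mul_one] at h'
      · refine Or.inr ⟨k * k', hs.trans _ _ _ hk ?_, by simp [mul_assoc]⟩
        simpa using hsm k _ _ hk'
  · rintro h a b (H | ⟨k, hk, rfl⟩)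
    · left; rw [map_mul, map_mul]; exact hrm _ _ _ H
    · exact Or.inr ⟨k, hk, by rw [mul_assoc]⟩

/-- A left-invariant family of strict total orders `ind o · · = 1`, one for each starting point `o`,
obtained by cutting a circular order open. -/
structure CutOrders (G : Type u) [Group G] where
  /-- The indicator of the order cut open at the first argument. -/
  ind : G → G → G → ℤ
  ind_eq : ∀ o x y, ind o x y = 0 ∨ ind o x y = 1
  ind_self : ∀ o x, ind o x x = 0
  ind_right : ∀ o x, ind o x o = 0
  ind_add_swap : ∀ o x y, x ≠ y → ind o x y + ind o y x = 1
  ind_add : ∀ o p q s, ind o q p + ind o s q = ind o s p + ind p s q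
  ind_mul : ∀ h o x y, ind (h * o) (h * x) (h * y) = ind o x y

theorem IsCircularlyOrderable.nonempty_cutOrders {G : Type u} [Group G]
    (hG : IsCircularlyOrderable G) : Nonempty (CutOrders G) := by
  classical
  obtain ⟨c, h1, h2, h3, h4⟩ := hG
  let δ (x y : G) : ℤ := if x = y then 1 else 0
  let I (o x y : G) : ℤ := if c o x y = 1 ∨ x = o ∧ y ≠ o then 1 else 0
  have δ_comm (x y : G) : δ x y = δ y x := by simp only [δ, eq_comm]
  have hI (o x y : G) : 2 * I o x y = c o x y + 1 - δ x y + δ x o - δ y o := by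
    have a1 := h1 o x y
    have a2 := h2 o x y
    simp only [I, δ]
    grind
  have hI01 (o x y : G) : I o x y = 0 ∨ I o x y = 1 := by
    simp only [I]; split_ifs <;> simp
  have deg (x y z : G) (h : x = y ∨ x = z ∨ y = z) : c x y z = 0 := (h2 x y z).2 h
  have sw12 (x y z : G) : c y x z = - c x y z := by
    have := h3 x y x z
    rw [deg x x z (by simp), deg x y x (by simp)] at this
    linarith
  have sw23 (x y z : G) : c x z y = - c x y z := by
    have := h3 x y z y
    rw [deg y z y (by simp), deg x y y (by simp)] at this
    linarith
  refine ⟨⟨I, hI01, fun o x => ?_, fun o x => ?_, fun o x y hxy => ?_, fun o p q s => ?_,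
    fun h o x y => ?_⟩⟩
  · have := hI o x x
    rw [deg o x x (by simp)] at this
    simp only [δ, if_true] at this
    linarith
  · have := hI o x o
    rw [deg o x o (by simp)] at this
    simp only [δ, if_true] at this
    linarith
  · have a := hI o x y
    have b := hI o y x
    have d : δ x y = 0 := if_neg hxy
    rw [sw23, δ_comm y x] at b
    linarith
  · have a1 := hI o q p
    have a2 := hI o s q
    have a3 := hI o s p
    have a4 := hI p s q
    have a5 := h3 o s q p
    have a6 := sw12 s p q
    have a7 := sw23 s p q
    rw [δ_comm p o] at *
    rw [δ_comm q p] at *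
    linarith
  · simp only [I, ← h4, mul_right_inj, ne_eq]

namespace CutOrders

variable {G : Type u} [Group G]

/-- The central extension of `G` by `ℤ` determined by a circular order. -/
structure Cover (C : CutOrders G) : Type u where
  /-- The integer coordinate. -/
  height : ℤ
  /-- The group coordinate. -/
  point : G

variable (C : CutOrders G)

theorem ind_one_left_mul (g x y : G) : C.ind 1 x y = C.ind g (g * x) (g * y) := by
  have := C.ind_mul g 1 x y
  rw [mul_one] at this
  exact this.symm

namespace Cover

variable {C}

@[ext]
theorem ext {a b : C.Cover} (h : a.height = b.height) (h' : a.point = b.point) : a = b := by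
  cases a; cases b; simp_all

instance : Mul C.Cover :=
  ⟨fun a b => ⟨a.height + b.height + C.ind 1 (a.point * b.point) a.point, a.point * b.point⟩⟩

instance : One C.Cover := ⟨⟨0, 1⟩⟩

instance : Inv C.Cover := ⟨fun a => ⟨-a.height - C.ind 1 1 a.point⁻¹, a.point⁻¹⟩⟩

@[simp]
theorem mul_height (a b : C.Cover) :
    (a * b).height = a.height + b.height + C.ind 1 (a.point * b.point) a.point := rfl

@[simp]
theorem mul_point (a b : C.Cover) : (a * b).point = a.point * b.point := rfl

@[simp]
theorem one_height : (1 : C.Cover).height = 0 := rfl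

@[simp]
theorem one_point : (1 : C.Cover).point = 1 := rfl

@[simp]
theorem inv_height (a : C.Cover) : a⁻¹.height = -a.height - C.ind 1 1 a.point⁻¹ := rfl

@[simp]
theorem inv_point (a : C.Cover) : a⁻¹.point = a.point⁻¹ := rfl

instance : Group C.Cover :=
  Group.ofLeftAxioms
    (fun a b c => by
      refine ext ?_ (mul_assoc _ _ _)
      have h := C.ind_add 1 a.point (a.point * b.point) (a.point * b.point * c.point)
      have h' := C.ind_one_left_mul a.point (b.point * c.point) b.point
      rw [← mul_assoc] at h'
      simp only [mul_height, mul_point, ← mul_assoc]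
      linarith)
    (fun a => ext (by simp [C.ind_right]) (one_mul _))
    (fun a => ext (by simp; ring) (inv_mul_cancel _))

/-- The projection of the cover to `G`. -/
def proj : C.Cover →* G := MonoidHom.mk' point mul_point

theorem proj_surjective : Function.Surjective (proj : C.Cover →* G) := fun g => ⟨⟨0, g⟩, rfl⟩

theorem mem_center (a : C.Cover) (ha : proj a = 1) : a ∈ Subgroup.center C.Cover := by
  have ha' : a.point = 1 := ha
  rw [Subgroup.mem_center_iff]
  intro b
  refine ext ?_ (by simp [ha'])
  simp only [mul_height, ha', mul_one, one_mul, C.ind_self, C.ind_right]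
  ring

theorem isLeftOrderable : IsLeftOrderable C.Cover := by
  refine ⟨fun a b => a.height < b.height ∨ a.height = b.height ∧ C.ind 1 a.point b.point = 1,
    ?_, ?_⟩
  · refine { trichotomous := fun a b h h' => ?_, irrefl := ?_, trans := ?_ }
    · push Not at h h'
      have hh : a.height = b.height := le_antisymm h'.1 h.1
      refine ext hh ?_
      by_contra hne
      have h1 := C.ind_add_swap 1 _ _ hne
      have h2 := (C.ind_eq 1 a.point b.point).resolve_right (h.2 hh)
      have h3 := (C.ind_eq 1 b.point a.point).resolve_right (h'.2 hh.symm)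
      omega
    · rintro a (h | ⟨_, h⟩)
      · exact lt_irrefl _ h
      · rw [C.ind_self] at h; omega
    · rintro a b c h h'
      have h1 := C.ind_add 1 c.point b.point a.point
      have h2 := C.ind_eq 1 a.point c.point
      have h3 := C.ind_eq c.point a.point b.point
      omega
  · rintro g a b h
    have h0 := C.ind_one_left_mul g.point a.point b.point
    have h1 := C.ind_add 1 g.point (g.point * b.point) (g.point * a.point)
    have h2 := C.ind_eq 1 (g.point * a.point) g.point
    have h3 := C.ind_eq 1 (g.point * b.point) g.point
    have h4 := C.ind_eq 1 (g.point * a.point) (g.point * b.point)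
    have h5 := C.ind_eq g.point (g.point * a.point) (g.point * b.point)
    simp only [mul_height, mul_point]
    omega

end Cover

end CutOrders

/-- If `G` is circularly orderable, `H₁(G)` is finitely generated free
abelian and `H₂(G)` is torsion-free, then the nonabelian tensor square `G ⊗ G` is
left-orderable. -/
theorem tensorSquare_leftOrderable
    (G : Type u) [Group G]
    (hG : IsCircularlyOrderable G)
    (hH1 : ∃ n : ℕ, Nonempty (Additive (Abelianization G) ≃+ (Fin n → ℤ)))
    (hH2 : ∀ a : H2 G, IsOfFinOrder a → a = 1) :
    IsLeftOrderable (TensorSquare G) := by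
  obtain ⟨n, ⟨e⟩⟩ := hH1
  let e' : Additive (Abelianization G) ≃ₗ[ℤ] (Fin n → ℤ) := e.toIntLinearEquiv
  have : Module.Free ℤ (Additive (Abelianization G)) := Module.Free.of_equiv e'.symm
  have : Module.Finite ℤ (Additive (Abelianization G)) := Module.Finite.equiv e'.symm
  have hfg : Group.FG (Abelianization G) :=
    GroupFG.iff_add_fg.2 (Module.Finite.iff_addGroup_fg.1 this)
  obtain ⟨C⟩ := hG.nonempty_cutOrders
  obtain ⟨f, hf⟩ := TensorSquare.exists_hom_of_central CutOrders.Cover.proj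
    (CutOrders.Cover.proj_surjective (C := C)) CutOrders.Cover.mem_center
  have hpf : CutOrders.Cover.proj.comp f = TensorSquare.comm := TensorSquare.hom_ext fun a b => by
    obtain ⟨u, rfl⟩ := CutOrders.Cover.proj_surjective (C := C) a
    obtain ⟨v, rfl⟩ := CutOrders.Cover.proj_surjective (C := C) b
    rw [MonoidHom.comp_apply, hf, TensorSquare.comm_tmul]; simp
  have hker {t : TensorSquare G} (ht : t ∈ f.ker) : TensorSquare.comm t = 1 := by
    rw [← hpf, MonoidHom.comp_apply, MonoidHom.mem_ker.1 ht, map_one]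
  refine isLeftOrderable_of_ker f CutOrders.Cover.isLeftOrderable ?_
  let : CommGroup f.ker :=
    { (inferInstance : Group f.ker) with
      mul_comm := fun a b => Subtype.ext (TensorSquare.commute_of_comm (hker b.2) a) }
  have : IsMulTorsionFree f.ker := by
    refine ⟨fun n hn a b hab => ?_⟩
    have h1 : (a * b⁻¹) ^ n = 1 := by
      have hab' : a ^ n = b ^ n := hab
      rw [mul_pow, inv_pow, hab', mul_inv_cancel]
    have h2 : IsOfFinOrder ((a * b⁻¹ : f.ker) : TensorSquare G) :=
      isOfFinOrder_iff_pow_eq_one.2 ⟨n, Nat.pos_of_ne_zero hn, congrArg Subtype.val h1⟩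
    have h3 := TensorSquare.eq_one_of_mem_diag
      (TensorSquare.mem_diag_of_isOfFinOrder hfg hH2 (hker (a * b⁻¹).2) h2) h2
    exact mul_inv_eq_one.1 (Subtype.ext h3)
  exact isLeftOrderable_of_isMulTorsionFree f.ker
end
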